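/- There is a constant C > 0 depending only on c and d such that the following holds. Consider the (1+1) EA on the mirrored-profit instance of the chance-constrained knapsack problem with correlated uniform weights, with n ≥ 2 and positive integer profits, for any K, m ≥ 1 (n = K·m), any a > 0, B > 0, 0 < α < 1, and any profits satisfying the mirrored-profit condition; let p_max = max_{i,j} p_{ij}. For every initial solution x₀ ∈ {0,1}^n, the expected number of iterations until the current solution is, for the first time, a feasible solution of maximal profit among all feasible solutions is at most C·n³·(1 + log n + log p_max). -/

import Mathlib

open Finset
open scoped ENNReal

noncomputable section

/-- Number of one-bits (selected items) of a solution. -/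
def numOnes (K m : ℕ) (x : Fin K → Fin m → Bool) : ℕ :=
  ∑ i, ∑ j, if x i j then 1 else 0

/-- Covariance contribution `2c·Σᵢ Σ_{j1<j2} x_{ij1}·x_{ij2}` of a solution. -/
def cova (K m : ℕ) (c : ℝ) (x : Fin K → Fin m → Bool) : ℝ :=
  2 * c * ∑ i, ∑ p ∈ Finset.univ.filter (fun p : Fin m × Fin m => p.1 < p.2),
      (if x i p.1 then (1 : ℝ) else 0) * (if x i p.2 then (1 : ℝ) else 0)

/-- Expected weight `E[W(x)] = a·|x|₁`. -/
def expWeight (K m : ℕ) (a : ℝ) (x : Fin K → Fin m → Bool) : ℝ :=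
  a * (numOnes K m x : ℝ)

/-- Variance `Var[W(x)] = d·|x|₁ + 2c·Σᵢ Σ_{j1<j2} x_{ij1}·x_{ij2}`. -/
def varWeight (K m : ℕ) (d c : ℝ) (x : Fin K → Fin m → Bool) : ℝ :=
  d * (numOnes K m x : ℝ) + cova K m c x

/-- Chebyshev surrogate `β(x) = Var[W(x)] / (Var[W(x)] + (B − E[W(x)])²)`. -/
def chebBeta (K m : ℕ) (a d c B : ℝ) (x : Fin K → Fin m → Bool) : ℝ :=
  varWeight K m d c x / (varWeight K m d c x + (B - expWeight K m a x) ^ 2)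

/-- A solution is feasible if `E[W(x)] < B` and `β(x) ≤ α`. -/
def feasible (K m : ℕ) (a d c B α : ℝ) (x : Fin K → Fin m → Bool) : Prop :=
  expWeight K m a x < B ∧ chebBeta K m a d c B x ≤ α

/-- `β'(x) = β(x)` if `E[W(x)] < B`, and `β'(x) = 1 + E[W(x)] − B` otherwise. -/
def betaPrime (K m : ℕ) (a d c B : ℝ) (x : Fin K → Fin m → Bool) : ℝ :=
  if expWeight K m a x < B then chebBeta K m a d c B x else 1 + expWeight K m a x - B

/-- Total profit `p(x) = Σᵢⱼ p_{ij}·x_{ij}`. -/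
def profitOf (K m : ℕ) (profit : Fin K → Fin m → ℝ) (x : Fin K → Fin m → Bool) : ℝ :=
  ∑ i, ∑ j, if x i j then profit i j else 0

/-- `p'(x) = −1` if `β'(x) > α`, and `p'(x) = p(x)` otherwise. -/
def pPrime (K m : ℕ) (a d c B α : ℝ) (profit : Fin K → Fin m → ℝ)
    (x : Fin K → Fin m → Bool) : ℝ :=
  if α < betaPrime K m a d c B x then -1 else profitOf K m profit x

/-- Lexicographic fitness dominance: `f(y) ⪰ f(x)` iff `p'(y) > p'(x)`, or
`p'(y) = p'(x)` and `β'(y) ≤ β'(x)`. -/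
def fge (K m : ℕ) (a d c B α : ℝ) (profit : Fin K → Fin m → ℝ)
    (y x : Fin K → Fin m → Bool) : Prop :=
  pPrime K m a d c B α profit x < pPrime K m a d c B α profit y ∨
    (pPrime K m a d c B α profit y = pPrime K m a d c B α profit x ∧
      betaPrime K m a d c B y ≤ betaPrime K m a d c B x)

/-- Hamming distance between two solutions. -/
def hdist (K m : ℕ) (x y : Fin K → Fin m → Bool) : ℕ :=
  ∑ i, ∑ j, if x i j = y i j then 0 else 1

/-- Standard-bit mutation of the (1+1) EA: each bit flips independently with
probability `1/n`, so `y` is produced from `x` with probability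
`(1/n)^{H(x,y)}·(1 − 1/n)^{n − H(x,y)}`. -/
def mutEA (K m : ℕ) (x y : Fin K → Fin m → Bool) : ℝ≥0∞ :=
  (1 / (K * m : ℝ≥0∞)) ^ hdist K m x y *
    (1 - 1 / (K * m : ℝ≥0∞)) ^ (K * m - hdist K m x y)

/-- RLS mutation: with probability `1/2` flip one uniformly random bit, with probability
`1/2` flip a uniformly random pair of distinct bits; so a one-bit-flip neighbour is
produced with probability `1/(2n)` and a two-bit-flip neighbour with probability
`1/(n(n−1))`. -/
def mutRLS (K m : ℕ) (x y : Fin K → Fin m → Bool) : ℝ≥0∞ :=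
  if hdist K m x y = 1 then 1 / (2 * (K * m : ℝ≥0∞))
  else if hdist K m x y = 2 then 1 / ((K * m : ℝ≥0∞) * ((K * m : ℝ≥0∞) - 1))
  else 0

open scoped Classical in
/-- One-step transition probability of an elitist algorithm with mutation distribution
`mutD` and acceptance relation `acc y x` (= "`f(y) ⪰ f(x)`"): the offspring is accepted
iff `acc`, otherwise the algorithm stays at `x`. -/
def stepP (K m : ℕ)
    (mutD : (Fin K → Fin m → Bool) → (Fin K → Fin m → Bool) → ℝ≥0∞)
    (acc : (Fin K → Fin m → Bool) → (Fin K → Fin m → Bool) → Prop)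
    (x y : Fin K → Fin m → Bool) : ℝ≥0∞ :=
  (if acc y x then mutD x y else 0) +
    (if y = x then ∑ z, (if acc z x then 0 else mutD x z) else 0)

open scoped Classical in
/-- `hitVec K m P A x₀ t y` is the probability that the Markov chain with transition
matrix `P` started at `x₀` has not visited the target set `A` during the first `t` steps
and is currently at `y`. -/
def hitVec (K m : ℕ)
    (P : (Fin K → Fin m → Bool) → (Fin K → Fin m → Bool) → ℝ≥0∞)
    (A : (Fin K → Fin m → Bool) → Prop) (x₀ : Fin K → Fin m → Bool) :
    ℕ → (Fin K → Fin m → Bool) → ℝ≥0∞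
  | 0 => fun y => if y = x₀ ∧ ¬ A y then 1 else 0
  | (t + 1) => fun y => if A y then 0 else ∑ x, hitVec K m P A x₀ t x * P x y

/-- Expected hitting time `E[min {t : X_t ∈ A}]` of the target set `A` for the Markov
chain with transition matrix `P` started at `x₀`, computed as `Σ_{t≥0} Pr(T > t)`. -/
def expHitTime (K m : ℕ)
    (P : (Fin K → Fin m → Bool) → (Fin K → Fin m → Bool) → ℝ≥0∞)
    (A : (Fin K → Fin m → Bool) → Prop) (x₀ : Fin K → Fin m → Bool) : ℝ≥0∞ :=
  ∑' t : ℕ, ∑ y, hitVec K m P A x₀ t y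

/-- Covariance `s_ℓ^b` of a balanced solution with `ℓ` one-bits: with `q = ⌊ℓ/K⌋` and
`t = ℓ − qK`, it is `c·[(K − t)·q(q − 1) + t·(q + 1)q]`. -/
def balCov (K : ℕ) (c : ℝ) (ℓ : ℕ) : ℝ :=
  c * (((K - (ℓ - (ℓ / K) * K)) * ((ℓ / K) * (ℓ / K - 1)) +
        (ℓ - (ℓ / K) * K) * ((ℓ / K + 1) * (ℓ / K)) : ℕ) : ℝ)

/-- The solution obtained from `y` by setting bit `(i, j)` to one. -/
def flipUp (K m : ℕ) (y : Fin K → Fin m → Bool) (i : Fin K) (j : Fin m) :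
    Fin K → Fin m → Bool :=
  fun i' j' => if i' = i ∧ j' = j then true else y i' j'

end

noncomputable section Helpers

variable {K m : ℕ}

/-- row count -/
def rc (x : Fin K → Fin m → Bool) (i : Fin K) : ℕ := ∑ j, if x i j then 1 else 0

def prN (prof : Fin m → ℕ) (x : Fin K → Fin m → Bool) : ℕ :=
  ∑ i, ∑ j, if x i j then prof j else 0

def setBit (x : Fin K → Fin m → Bool) (e : Fin K × Fin m) (b : Bool) : Fin K → Fin m → Bool :=
  fun i j => if i = e.1 ∧ j = e.2 then b else x i j

def swp (x : Fin K → Fin m → Bool) (e f : Fin K × Fin m) : Fin K → Fin m → Bool :=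
  setBit (setBit x e false) f true

lemma row_set {M : Type*} [AddCommMonoid M] (w : Fin m → M) (x : Fin K → Fin m → Bool)
    (e : Fin K × Fin m) (h : x e.1 e.2 = false) (i : Fin K) :
    (∑ j, if setBit x e true i j then w j else 0)
      = (∑ j, if x i j then w j else 0) + if i = e.1 then w e.2 else 0 := by
  obtain ⟨a, b⟩ := e
  simp only at h ⊢
  by_cases hi : i = a
  · subst hi
    have : ∀ j, (if setBit x (i, b) true i j then w j else 0)
        = (if x i j then w j else 0) + (if j = b then w j else 0) := by
      intro j
      by_cases hj : j = b
      · subst hj; simp [setBit, h]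
      · simp [setBit, hj]
    simp [this, Finset.sum_add_distrib]
  · simp [setBit, hi]

lemma setBit_restore (x : Fin K → Fin m → Bool) (e : Fin K × Fin m) (h : x e.1 e.2 = true) :
    setBit (setBit x e false) e true = x := by
  funext i j
  by_cases hh : i = e.1 ∧ j = e.2
  · obtain ⟨rfl, rfl⟩ := hh; simp [setBit, h]
  · simp [setBit, hh]

lemma setBit_self (x : Fin K → Fin m → Bool) (e : Fin K × Fin m) (b : Bool) :
    setBit x e b e.1 e.2 = b := by simp [setBit]

lemma rc_true (x : Fin K → Fin m → Bool) (e : Fin K × Fin m) (h : x e.1 e.2 = false) (i : Fin K) :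
    rc (setBit x e true) i = rc x i + if i = e.1 then 1 else 0 := by
  have := row_set (M := ℕ) (fun _ => 1) x e h i
  exact this

lemma rc_false (x : Fin K → Fin m → Bool) (e : Fin K × Fin m) (h : x e.1 e.2 = true) (i : Fin K) :
    rc x i = rc (setBit x e false) i + if i = e.1 then 1 else 0 := by
  have := rc_true (setBit x e false) e (setBit_self _ _ _) i
  rwa [setBit_restore x e h] at this

lemma pr_true (prof : Fin m → ℕ) (x : Fin K → Fin m → Bool) (e : Fin K × Fin m)
    (h : x e.1 e.2 = false) :
    prN prof (setBit x e true) = prN prof x + prof e.2 := by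
  unfold prN
  simp [row_set prof x e h, Finset.sum_add_distrib]

lemma pr_false (prof : Fin m → ℕ) (x : Fin K → Fin m → Bool) (e : Fin K × Fin m)
    (h : x e.1 e.2 = true) :
    prN prof x = prN prof (setBit x e false) + prof e.2 := by
  have := pr_true prof (setBit x e false) e (setBit_self _ _ _)
  rwa [setBit_restore x e h] at this

lemma numOnes_eq (x : Fin K → Fin m → Bool) : numOnes K m x = ∑ i, rc x i := rfl

lemma no_true (x : Fin K → Fin m → Bool) (e : Fin K × Fin m) (h : x e.1 e.2 = false) :
    numOnes K m (setBit x e true) = numOnes K m x + 1 := by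
  simp [numOnes_eq, rc_true x e h, Finset.sum_add_distrib]

lemma no_false (x : Fin K → Fin m → Bool) (e : Fin K × Fin m) (h : x e.1 e.2 = true) :
    numOnes K m x = numOnes K m (setBit x e false) + 1 := by
  simp [numOnes_eq, rc_false x e h, Finset.sum_add_distrib]

lemma profitOf_eq (prof : Fin m → ℕ) (x : Fin K → Fin m → Bool) :
    profitOf K m (fun _ j => (prof j : ℝ)) x = (prN prof x : ℝ) := by
  simp [profitOf, prN]

lemma pair_sum (g : Fin m → ℝ) (hg : ∀ j, g j * g j = g j) :
    2 * ∑ p ∈ Finset.univ.filter (fun p : Fin m × Fin m => p.1 < p.2), g p.1 * g p.2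
      = (∑ j, g j) * (∑ j, g j) - ∑ j, g j := by
  have h1 : (∑ j, g j) * (∑ j, g j) = ∑ p : Fin m × Fin m, g p.1 * g p.2 := by
    rw [Finset.sum_mul_sum, Fintype.sum_prod_type]
  have h2 : ∀ p : Fin m × Fin m, g p.1 * g p.2 =
      (if p.1 < p.2 then g p.1 * g p.2 else 0) + (if p.2 < p.1 then g p.1 * g p.2 else 0)
       + (if p.1 = p.2 then g p.1 * g p.2 else 0) := by
    rintro ⟨a, b⟩
    rcases lt_trichotomy a b with h | h | h
    · simp [h, h.not_gt, h.ne]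
    · simp [h]
    · simp [h, h.not_gt, h.ne']
  have h3 : (∑ p : Fin m × Fin m, if p.2 < p.1 then g p.1 * g p.2 else 0)
      = ∑ p : Fin m × Fin m, if p.1 < p.2 then g p.1 * g p.2 else 0 := by
    rw [← Equiv.sum_comp (Equiv.prodComm (Fin m) (Fin m))]
    simp [mul_comm]
  have h4 : (∑ p : Fin m × Fin m, if p.1 = p.2 then g p.1 * g p.2 else 0) = ∑ j, g j := by
    rw [Fintype.sum_prod_type]
    simp [hg]
  rw [h1, Finset.sum_filter, Finset.sum_congr rfl (fun p _ => h2 p), Finset.sum_add_distrib,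
    Finset.sum_add_distrib, h3, h4]
  ring

lemma var_eq (d c : ℝ) (x : Fin K → Fin m → Bool) :
    varWeight K m d c x = d * numOnes K m x + c * ∑ i, ((rc x i : ℝ) * rc x i - rc x i) := by
  unfold varWeight cova
  rw [mul_comm 2 c, mul_assoc, Finset.mul_sum]
  congr 2
  refine Finset.sum_congr rfl fun i _ => ?_
  rw [pair_sum (fun j => if x i j then (1:ℝ) else 0) (fun j => by simp)]
  simp [rc]

lemma var_true (d c : ℝ) (x : Fin K → Fin m → Bool) (e : Fin K × Fin m) (h : x e.1 e.2 = false) :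
    varWeight K m d c (setBit x e true) = varWeight K m d c x + d + 2 * c * rc x e.1 := by
  rw [var_eq, var_eq, no_true x e h]
  have : ∀ i, ((rc (setBit x e true) i : ℝ) * rc (setBit x e true) i - rc (setBit x e true) i)
     = ((rc x i : ℝ) * rc x i - rc x i) + if i = e.1 then 2 * (rc x i : ℝ) else 0 := by
    intro i
    rw [rc_true x e h]
    split_ifs
    · push_cast; ring
    · push_cast; ring
  simp only [this, Finset.sum_add_distrib, Finset.sum_ite_eq', Finset.mem_univ, if_true]
  push_cast; ring

lemma var_false (d c : ℝ) (x : Fin K → Fin m → Bool) (e : Fin K × Fin m) (h : x e.1 e.2 = true) :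
    varWeight K m d c x = varWeight K m d c (setBit x e false) + d + 2 * c * ((rc x e.1 : ℝ) - 1) := by
  have := var_true d c (setBit x e false) e (setBit_self _ _ _)
  rw [setBit_restore x e h] at this
  rw [this, rc_false x e h e.1]
  simp

lemma swp_mid {x : Fin K → Fin m → Bool} {e f : Fin K × Fin m} (_ : x e.1 e.2 = true)
    (hf : x f.1 f.2 = false) : setBit x e false f.1 f.2 = false := by
  unfold setBit; split_ifs <;> simp [hf]

lemma rc_swp {x : Fin K → Fin m → Bool} {e f : Fin K × Fin m} (he : x e.1 e.2 = true)
    (hf : x f.1 f.2 = false) (i : Fin K) :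
    rc (swp x e f) i + (if i = e.1 then 1 else 0) = rc x i + (if i = f.1 then 1 else 0) := by
  unfold swp
  rw [rc_true _ f (swp_mid he hf), rc_false x e he]; ring

lemma no_swp {x : Fin K → Fin m → Bool} {e f : Fin K × Fin m} (he : x e.1 e.2 = true)
    (hf : x f.1 f.2 = false) :
    numOnes K m (swp x e f) = numOnes K m x := by
  unfold swp
  rw [no_true _ f (swp_mid he hf), no_false x e he]

lemma pr_swp (prof : Fin m → ℕ) {x : Fin K → Fin m → Bool} {e f : Fin K × Fin m}
    (he : x e.1 e.2 = true) (hf : x f.1 f.2 = false) :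
    (prN prof (swp x e f) : ℝ) = prN prof x + (prof f.2 - prof e.2) := by
  unfold swp
  rw [pr_true _ _ f (swp_mid he hf), pr_false prof x e he]; push_cast; ring

/-- variance drop of a swap -/
def drp (c : ℝ) (x : Fin K → Fin m → Bool) (e f : Fin K × Fin m) : ℝ :=
  if e.1 = f.1 then 0 else 2 * c * ((rc x e.1 : ℝ) - rc x f.1 - 1)

lemma var_swp (d c : ℝ) {x : Fin K → Fin m → Bool} {e f : Fin K × Fin m}
    (he : x e.1 e.2 = true) (hf : x f.1 f.2 = false) :
    varWeight K m d c (swp x e f) = varWeight K m d c x - drp c x e f := by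
  unfold swp drp
  rw [var_true _ _ _ f (swp_mid he hf), var_false d c x e he]
  have := rc_false x e he f.1
  split_ifs with h
  · rw [h, this, if_pos h.symm]; push_cast; ring
  · rw [if_neg (fun h' => h h'.symm), add_zero] at this
    rw [← this]; ring

lemma swp_apply (x : Fin K → Fin m → Bool) (e f : Fin K × Fin m) (i : Fin K) (j : Fin m) :
    swp x e f i j = if i = f.1 ∧ j = f.2 then true else if i = e.1 ∧ j = e.2 then false
      else x i j := rfl

lemma swp_inj {x : Fin K → Fin m → Bool} {e f e' f' : Fin K × Fin m} (he : x e.1 e.2 = true)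
    (hf : x f.1 f.2 = false) (he' : x e'.1 e'.2 = true)
    (hf' : x f'.1 f'.2 = false) (h : swp x e f = swp x e' f') : (e, f) = (e', f') := by
  obtain ⟨e1, e2⟩ := e
  obtain ⟨f1, f2⟩ := f
  obtain ⟨e1', e2'⟩ := e'
  obtain ⟨f1', f2'⟩ := f'
  have h1 := congrFun (congrFun h e1) e2
  have h2 := congrFun (congrFun h f1) f2
  simp only [swp_apply] at h1 h2 he hf he' hf' ⊢
  grind

lemma hdist_tri (x y z : Fin K → Fin m → Bool) : hdist K m x z ≤ hdist K m x y + hdist K m y z := by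
  unfold hdist
  simp only [← Finset.sum_add_distrib]
  refine Finset.sum_le_sum fun i _ => Finset.sum_le_sum fun j _ => ?_
  grind

lemma hdist_setBit (x : Fin K → Fin m → Bool) (e : Fin K × Fin m) (b : Bool) :
    hdist K m x (setBit x e b) ≤ 1 := by
  unfold hdist
  calc _ ≤ ∑ i, ∑ j, (if i = e.1 then (if j = e.2 then 1 else 0) else 0) := by
        refine Finset.sum_le_sum fun i _ => Finset.sum_le_sum fun j _ => ?_
        unfold setBit
        grind
    _ = 1 := by
        have : ∀ i, (∑ j, (if i = e.1 then (if j = e.2 then 1 else 0) else 0)) = if i = e.1 then 1 else 0 := by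
          intro i; split_ifs <;> simp
        simp only [this]; simp

lemma hdist_swp (x : Fin K → Fin m → Bool) (e f : Fin K × Fin m) :
    hdist K m x (swp x e f) ≤ 2 :=
  (hdist_tri _ (setBit x e false) _).trans (Nat.add_le_add (hdist_setBit _ _ _) (hdist_setBit _ _ _))

lemma rc_le_of_sub {x y : Fin K → Fin m → Bool} {i : Fin K}
    (h : ∀ j, x i j = true → y i j = true) : rc x i ≤ rc y i := by
  unfold rc
  refine Finset.sum_le_sum fun j _ => ?_
  have := h j
  grind

lemma rc_lt_of_ssub {x y : Fin K → Fin m → Bool} {i : Fin K}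
    (h : ∀ j, x i j = true → y i j = true) (j : Fin m) (hx : x i j = false) (hy : y i j = true) :
    rc x i < rc y i := by
  unfold rc
  refine Finset.sum_lt_sum (fun j _ => ?_) ⟨j, Finset.mem_univ _, by simp [hx, hy]⟩
  have := h j
  grind

lemma match_aux (prof : Fin m → ℕ) (d c : ℝ) (hc : 0 < c) (T : Fin K → Fin m → Bool)
    (hbal : ∀ i j, rc T i ≤ rc T j + 1) : ∀ (M : ℕ) (x : Fin K → Fin m → Bool),
    numOnes K m x = numOnes K m T →
    (Finset.univ.filter (fun e : Fin K × Fin m => x e.1 e.2 = true ∧ T e.1 e.2 = false)).card = M →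
    ∃ S : Finset ((Fin K × Fin m) × (Fin K × Fin m)),
      (∀ s ∈ S, x s.1.1 s.1.2 = true ∧ T s.1.1 s.1.2 = false ∧ x s.2.1 s.2.2 = false ∧
        T s.2.1 s.2.2 = true ∧
        (s.1.1 = s.2.1 ∨ (rc T s.1.1 < rc x s.1.1 ∧ rc x s.2.1 < rc T s.2.1))) ∧
      (∑ s ∈ S, ((prof s.2.2 : ℝ) - prof s.1.2)) = prN prof T - prN prof x ∧
      varWeight K m d c x - varWeight K m d c T ≤ ∑ s ∈ S, drp c x s.1 s.2 ∧
      varWeight K m d c T ≤ varWeight K m d c x := by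
  intro M
  induction M with
  | zero =>
    intro x hn h0
    rw [Finset.card_eq_zero, Finset.filter_eq_empty_iff] at h0
    have hsub : ∀ i j, x i j = true → T i j = true := by
      intro i j hx
      have := @h0 (i, j) (Finset.mem_univ _)
      simp only [not_and, Bool.not_eq_false] at this
      exact this hx
    have hxT : x = T := by
      by_contra hne
      obtain ⟨i, hi⟩ := Function.ne_iff.1 hne
      obtain ⟨j, hj⟩ := Function.ne_iff.1 hi
      have : numOnes K m x < numOnes K m T := by
        rw [numOnes_eq, numOnes_eq]
        refine Finset.sum_lt_sum (fun i _ => rc_le_of_sub (hsub i)) ⟨i, Finset.mem_univ _, ?_⟩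
        have := hsub i j
        exact rc_lt_of_ssub (hsub i) j (by grind) (by grind)
      omega
    subst hxT
    exact ⟨∅, by simp⟩
  | succ M ih =>
    intro x hn hM
    have hne : (Finset.univ.filter
      (fun e : Fin K × Fin m => x e.1 e.2 = true ∧ T e.1 e.2 = false)).Nonempty := by
      rw [← Finset.card_pos]; omega
    obtain ⟨e, he⟩ := hne
    rw [Finset.mem_filter] at he
    obtain ⟨-, hxe, hTe⟩ := he
    have hf : ∃ f : Fin K × Fin m, x f.1 f.2 = false ∧ T f.1 f.2 = true ∧
        (e.1 = f.1 ∨ (rc T e.1 < rc x e.1 ∧ rc x f.1 < rc T f.1)) := by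
      by_cases hz : ∃ j, x e.1 j = false ∧ T e.1 j = true
      · obtain ⟨j, h1, h2⟩ := hz
        exact ⟨(e.1, j), h1, h2, Or.inl rfl⟩
      · push Not at hz
        have h1 : rc T e.1 < rc x e.1 := by
          refine rc_lt_of_ssub (fun j hj => ?_) e.2 hTe hxe
          have := hz j
          grind
        have h2 : ∃ i, rc x i < rc T i := by
          by_contra hcon
          push Not at hcon
          have : numOnes K m T < numOnes K m x := by
            rw [numOnes_eq, numOnes_eq]
            exact Finset.sum_lt_sum (fun i _ => hcon i) ⟨e.1, Finset.mem_univ _, h1⟩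
          omega
        obtain ⟨i, hi⟩ := h2
        have h3 : ∃ j, x i j = false ∧ T i j = true := by
          by_contra hcon
          push Not at hcon
          have := rc_le_of_sub (x := T) (y := x) (i := i) (fun j hj => by have := hcon j; grind)
          omega
        obtain ⟨j, h4, h5⟩ := h3
        exact ⟨(i, j), h4, h5, Or.inr ⟨h1, hi⟩⟩
    obtain ⟨f, hxf, hTf, hrow⟩ := hf
    have hrc := fun i => rc_swp hxe hxf i
    have hcard : (Finset.univ.filter (fun g : Fin K × Fin m =>
        swp x e f g.1 g.2 = true ∧ T g.1 g.2 = false)).card = M := by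
      have : (Finset.univ.filter (fun g : Fin K × Fin m =>
        swp x e f g.1 g.2 = true ∧ T g.1 g.2 = false)) = (Finset.univ.filter (fun g : Fin K × Fin m =>
        x g.1 g.2 = true ∧ T g.1 g.2 = false)).erase e := by
        ext g
        obtain ⟨g1, g2⟩ := g
        obtain ⟨e1, e2⟩ := e
        obtain ⟨f1, f2⟩ := f
        simp only [Finset.mem_filter, Finset.mem_univ, true_and, Finset.mem_erase, swp_apply]
        grind
      rw [this, Finset.card_erase_of_mem (by simp [hxe, hTe]), hM]
      rfl
    obtain ⟨S, hS1, hS2, hS3, hS4⟩ := ih (swp x e f) ((no_swp hxe hxf).trans hn) hcard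
    have hnot : (e, f) ∉ S := by
      intro h
      have := (hS1 _ h).1
      simp only [swp_apply] at this
      grind
    have hv := var_swp d c hxe hxf
    have hdrp : 0 ≤ drp c x e f := by
      unfold drp
      split_ifs with h
      · exact le_rfl
      · have := hrow.resolve_left h
        have hb := hbal f.1 e.1
        have : rc x f.1 + 1 ≤ rc x e.1 := by omega
        have : (rc x f.1 : ℝ) + 1 ≤ rc x e.1 := by exact_mod_cast this
        have : 0 ≤ (rc x e.1 : ℝ) - rc x f.1 - 1 := by linarith
        positivity
    refine ⟨insert (e, f) S, ?_, ?_, ?_, by linarith⟩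
    · intro s hs
      rcases Finset.mem_insert.1 hs with rfl | hs'
      · exact ⟨hxe, hTe, hxf, hTf, hrow⟩
      · obtain ⟨⟨a1, a2⟩, ⟨b1, b2⟩⟩ := s
        obtain ⟨e1, e2⟩ := e
        obtain ⟨f1, f2⟩ := f
        obtain ⟨h1, h2, h3, h4, h5⟩ := hS1 _ hs'
        simp only [swp_apply] at h1 h2 h3 h4 h5 hxe hTe hxf hTf hrow hrc ⊢
        have ha := hrc a1
        have hb := hrc b1
        refine ⟨by grind, by grind, by grind, by grind, ?_⟩
        grind
    · rw [Finset.sum_insert hnot, hS2, pr_swp prof hxe hxf]; ring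
    · rw [Finset.sum_insert hnot]
      have : ∑ s ∈ S, drp c (swp x e f) s.1 s.2 ≤ ∑ s ∈ S, drp c x s.1 s.2 := by
        refine Finset.sum_le_sum fun s hs => ?_
        obtain ⟨⟨a1, a2⟩, ⟨b1, b2⟩⟩ := s
        obtain ⟨h1, h2, h3, h4, h5⟩ := hS1 _ hs
        simp only at h5
        unfold drp
        simp only
        split_ifs with h
        · exact le_rfl
        · have h6 := h5.resolve_left h
          have ha := hrc a1
          have hb := hrc b1
          have h7 : rc (swp x e f) a1 ≤ rc x a1 := by grind
          have h8 : rc x b1 ≤ rc (swp x e f) b1 := by grind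
          have h7 : (rc (swp x e f) a1 : ℝ) ≤ rc x a1 := by exact_mod_cast h7
          have h8 : (rc x b1 : ℝ) ≤ rc (swp x e f) b1 := by exact_mod_cast h8
          have : 0 < 2 * c := by linarith
          exact mul_le_mul_of_nonneg_left (by linarith) this.le
      linarith

/-- target balanced solution with `l` ones -/
def tgt (K m l : ℕ) : Fin K → Fin m → Bool := fun i j => decide ((i : ℕ) + K * (j : ℕ) < l)

lemma tgt_true {l : ℕ} (i : Fin K) (j : Fin m) : tgt K m l i j = true ↔ (i : ℕ) + K * j < l := by
  simp [tgt]

def nxt (K m l : ℕ) (h : l < K * m) : Fin K × Fin m :=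
  (⟨l % K, Nat.mod_lt _ (by by_contra h'; have : K = 0 := by omega
                            subst this; simp at h)⟩, ⟨l / K, Nat.div_lt_of_lt_mul h⟩)

lemma tgt_nxt_false {l : ℕ} (h : l < K * m) :
    tgt K m l (nxt K m l h).1 (nxt K m l h).2 = false := by
  simp [tgt, nxt, Nat.mod_add_div]

lemma tgt_succ {l : ℕ} (h : l < K * m) :
    tgt K m (l + 1) = setBit (tgt K m l) (nxt K m l h) true := by
  funext i j
  have h1 : (i = (nxt K m l h).1 ∧ j = (nxt K m l h).2) ↔ (i : ℕ) + K * j = l := by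
    simp only [nxt, Fin.ext_iff]
    constructor
    · rintro ⟨h1, h2⟩
      rw [h1, h2, Nat.mod_add_div]
    · intro h1
      have := i.2
      subst h1
      constructor
      · rw [Nat.add_mul_mod_self_left, Nat.mod_eq_of_lt this]
      · rw [Nat.add_mul_div_left _ _ (by omega), Nat.div_eq_of_lt this, zero_add]
  unfold setBit
  simp only [h1]
  unfold tgt
  split_ifs with h2
  · simp; omega
  · simp; omega

lemma no_tgt : ∀ {l : ℕ}, l ≤ K * m → numOnes K m (tgt K m l) = l := by
  intro l
  induction l with
  | zero => intro _; simp [numOnes, tgt]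
  | succ l ih =>
    intro h
    rw [tgt_succ h, no_true _ _ (tgt_nxt_false h), ih (by omega)]

lemma rc_le_of_sub' {x y : Fin K → Fin m → Bool} {i i' : Fin K}
    (h : ∀ j, x i j = true → y i' j = true) : rc x i ≤ rc y i' := by
  unfold rc
  refine Finset.sum_le_sum fun j _ => ?_
  have := h j
  grind

lemma cnt_lt (a : ℕ) (h : a ≤ m) : (∑ j : Fin m, if (j : ℕ) < a then 1 else 0) = a := by
  rw [Fin.sum_univ_eq_sum_range (fun j => if j < a then 1 else 0) m]
  rw [← Finset.sum_filter]
  simp only [Finset.sum_const, smul_eq_mul, mul_one]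
  have : (Finset.range m).filter (fun j => j < a) = Finset.range a := by ext; simp; omega
  rw [this, Finset.card_range]

lemma cnt_le (a : ℕ) : (∑ j : Fin m, if (j : ℕ) < a then 1 else 0) ≤ a := by
  rw [Fin.sum_univ_eq_sum_range (fun j => if j < a then 1 else 0) m]
  rw [← Finset.sum_filter]
  simp only [Finset.sum_const, smul_eq_mul, mul_one]
  calc _ ≤ (Finset.range a).card := Finset.card_le_card (by intro j; simp)
    _ = a := Finset.card_range a

lemma tgt_bal {l : ℕ} (h : l ≤ K * m) (i j : Fin K) : rc (tgt K m l) i ≤ rc (tgt K m l) j + 1 := by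
  have hK : 0 < K := by have := i.2; omega
  have h1 : rc (tgt K m l) i ≤ l / K + 1 := by
    refine le_trans ?_ (cnt_le (m := m) (l / K + 1))
    unfold rc
    refine Finset.sum_le_sum fun t _ => ?_
    have : (i : ℕ) + K * t < l → (t : ℕ) < l / K + 1 := by
      intro h
      rw [Nat.lt_succ_iff, Nat.le_div_iff_mul_le hK, mul_comm]; omega
    simp only [tgt, decide_eq_true_eq]
    grind
  have h2 : l / K ≤ rc (tgt K m l) j := by
    refine le_trans (cnt_lt (m := m) (l / K) (Nat.div_le_of_le_mul h)).ge ?_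
    unfold rc
    refine Finset.sum_le_sum fun t _ => ?_
    have : (t : ℕ) < l / K → (j : ℕ) + K * t < l := by
      intro h
      have h3 : (t : ℕ) + 1 ≤ l / K := h
      rw [Nat.le_div_iff_mul_le hK] at h3
      have := j.2
      nlinarith
    simp only [tgt, decide_eq_true_eq]
    grind
  omega

lemma add_item {prof : Fin m → ℕ} (hmono : ∀ j j' : Fin m, j ≤ j' → prof j' ≤ prof j)
    {l : ℕ} (h : l < K * m) (x : Fin K → Fin m → Bool) (hx : numOnes K m x = l) :
    ∃ f : Fin K × Fin m, x f.1 f.2 = false ∧ prof (nxt K m l h).2 ≤ prof f.2 ∧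
      rc x f.1 ≤ rc (tgt K m l) (nxt K m l h).1 := by
  have hlt : ∑ i, rc x i < ∑ i, rc (tgt K m (l + 1)) i := by
    rw [← numOnes_eq, ← numOnes_eq, hx, no_tgt h]; omega
  obtain ⟨i, -, hi⟩ := Finset.exists_lt_of_sum_lt hlt
  have h3 : ∃ j, x i j = false ∧ tgt K m (l + 1) i j = true := by
    by_contra hcon
    push Not at hcon
    have := rc_le_of_sub (x := tgt K m (l + 1)) (y := x) (i := i)
      (fun j hj => by have := hcon j; grind)
    omega
  obtain ⟨j, h4, h5⟩ := h3
  have hK : 0 < K := by have := i.2; omega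
  have key : ∀ t : Fin m, tgt K m (l + 1) i t = true → (t : ℕ) ≤ l / K := by
    intro t ht
    rw [tgt_true] at ht
    rw [Nat.le_div_iff_mul_le hK, mul_comm]; omega
  refine ⟨(i, j), h4, hmono _ _ (key j h5), ?_⟩
  have h6 : rc (tgt K m (l + 1)) i ≤ rc (tgt K m (l + 1)) (nxt K m l h).1 := by
    refine rc_le_of_sub' fun t ht => ?_
    rw [tgt_true]
    have h7 := Nat.mul_le_mul_left K (key t ht)
    have := Nat.mod_add_div l K
    simp only [nxt]
    omega
  have h8 : rc (tgt K m (l + 1)) (nxt K m l h).1 = rc (tgt K m l) (nxt K m l h).1 + 1 := by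
    rw [tgt_succ h, rc_true _ _ (tgt_nxt_false h), if_pos rfl]
  simp only
  omega

lemma tgt_top {prof : Fin m → ℕ} (hmono : ∀ j j' : Fin m, j ≤ j' → prof j' ≤ prof j)
    {l : ℕ} (e f : Fin K × Fin m) (he : tgt K m l e.1 e.2 = false) (hf : tgt K m l f.1 f.2 = true) :
    prof e.2 ≤ prof f.2 := by
  apply hmono
  rw [tgt_true] at hf
  have he' : ¬ tgt K m l e.1 e.2 = true := by simp [he]
  rw [tgt_true] at he'
  by_contra hlt
  have hlt : (e.2 : ℕ) + 1 ≤ f.2 := by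
    rw [not_le] at hlt; exact hlt
  have := Nat.mul_le_mul_left K hlt
  have := e.1.2
  rw [mul_add] at *
  omega

lemma swaps {prof : Fin m → ℕ} (hmono : ∀ j j' : Fin m, j ≤ j' → prof j' ≤ prof j)
    (d c : ℝ) (hc : 0 < c) {l : ℕ} (h : l ≤ K * m)
    (x : Fin K → Fin m → Bool) (hx : numOnes K m x = l) :
    ∃ S : Finset (Fin K → Fin m → Bool),
      (∀ y ∈ S, hdist K m x y ≤ 2 ∧ numOnes K m y = l ∧ prN prof x ≤ prN prof y ∧
        varWeight K m d c y ≤ varWeight K m d c x) ∧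
      (∑ y ∈ S, ((prN prof y : ℝ) - prN prof x)) = prN prof (tgt K m l) - prN prof x ∧
      varWeight K m d c x - varWeight K m d c (tgt K m l)
        ≤ ∑ y ∈ S, (varWeight K m d c x - varWeight K m d c y) ∧
      varWeight K m d c (tgt K m l) ≤ varWeight K m d c x ∧
      prN prof x ≤ prN prof (tgt K m l) := by
  obtain ⟨S, h1, h2, h3, h4⟩ := match_aux prof d c hc (tgt K m l) (tgt_bal h) _ x
    (hx.trans (no_tgt h).symm) rfl
  have hinj : Set.InjOn (fun s : (Fin K × Fin m) × (Fin K × Fin m) => swp x s.1 s.2) S := by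
    intro s hs t ht hst
    have a := h1 s hs
    have b := h1 t ht
    exact swp_inj a.1 a.2.2.1 b.1 b.2.2.1 hst
  have hgain : ∀ s ∈ S, prof s.1.2 ≤ prof s.2.2 := fun s hs => by
    have a := h1 s hs
    exact tgt_top hmono s.1 s.2 a.2.1 a.2.2.2.1
  refine ⟨S.image (fun s => swp x s.1 s.2), ?_, ?_, ?_, h4, ?_⟩
  · intro y hy
    obtain ⟨s, hs, rfl⟩ := Finset.mem_image.1 hy
    have a := h1 s hs
    refine ⟨hdist_swp _ _ _, (no_swp a.1 a.2.2.1).trans hx, ?_, ?_⟩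
    · have := pr_swp prof a.1 a.2.2.1
      have h5 : (prof s.1.2 : ℝ) ≤ prof s.2.2 := by exact_mod_cast hgain s hs
      have : (prN prof x : ℝ) ≤ prN prof (swp x s.1 s.2) := by linarith
      exact_mod_cast this
    · rw [var_swp d c a.1 a.2.2.1]
      have : 0 ≤ drp c x s.1 s.2 := by
        unfold drp
        split_ifs with h
        · exact le_rfl
        · have h6 := a.2.2.2.2.resolve_left h
          have hb := tgt_bal (K := K) (m := m) (l := l) (by assumption) s.2.1 s.1.1
          have : rc x s.2.1 + 1 ≤ rc x s.1.1 := by omega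
          have : (rc x s.2.1 : ℝ) + 1 ≤ rc x s.1.1 := by exact_mod_cast this
          have : 0 ≤ (rc x s.1.1 : ℝ) - rc x s.2.1 - 1 := by linarith
          positivity
      linarith
  · rw [Finset.sum_image hinj, ← h2]
    refine Finset.sum_congr rfl fun s hs => ?_
    have a := h1 s hs
    rw [pr_swp prof a.1 a.2.2.1]; ring
  · rw [Finset.sum_image hinj]
    refine h3.trans (le_of_eq ?_)
    refine Finset.sum_congr rfl fun s hs => ?_
    have a := h1 s hs
    rw [var_swp d c a.1 a.2.2.1]; ring
  · have : (0:ℝ) ≤ ∑ s ∈ S, ((prof s.2.2 : ℝ) - prof s.1.2) := by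
      refine Finset.sum_nonneg fun s hs => ?_
      have h5 : (prof s.1.2 : ℝ) ≤ prof s.2.2 := by exact_mod_cast hgain s hs
      linarith
    have : (prN prof x : ℝ) ≤ prN prof (tgt K m l) := by linarith
    exact_mod_cast this

/-! drift machinery -/

def mutR (x y : Fin K → Fin m → Bool) : ℝ :=
  (1 / (K * m : ℝ)) ^ hdist K m x y * (1 - 1 / (K * m : ℝ)) ^ (K * m - hdist K m x y)

lemma n_real (hn : 2 ≤ K * m) : (2:ℝ) ≤ (K:ℝ) * m := by exact_mod_cast hn

lemma pq (hn : 2 ≤ K * m) : 0 < 1 / ((K:ℝ) * m) ∧ 1 / ((K:ℝ) * m) ≤ 1 - 1 / ((K:ℝ) * m) := by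
  have h := n_real hn
  have : 1 / ((K:ℝ) * m) ≤ 1 / 2 := one_div_le_one_div_of_le (by norm_num) h
  exact ⟨by positivity, by linarith⟩

lemma mutR_nonneg (hn : 2 ≤ K * m) (x y : Fin K → Fin m → Bool) : 0 ≤ mutR x y := by
  obtain ⟨h1, h2⟩ := pq hn
  have : 0 ≤ 1 - 1 / ((K:ℝ) * m) := by linarith
  unfold mutR; positivity

lemma mutEA_eq (hn : 2 ≤ K * m) (x y : Fin K → Fin m → Bool) :
    mutEA K m x y = ENNReal.ofReal (mutR x y) := by
  obtain ⟨h1, h2⟩ := pq hn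
  have h0 : (0:ℝ) < (K:ℝ) * m := by linarith [n_real hn]
  have e1 : (1 / ((K:ℝ≥0∞) * m)) = ENNReal.ofReal (1 / ((K:ℝ) * m)) := by
    rw [ENNReal.ofReal_div_of_pos h0, ENNReal.ofReal_mul (by positivity)]
    simp
  unfold mutEA mutR
  rw [e1, ENNReal.ofReal_mul (by positivity), ENNReal.ofReal_pow h1.le,
    ENNReal.ofReal_pow (by linarith), ENNReal.ofReal_sub _ h1.le, ENNReal.ofReal_one]

lemma hdist_compl (x y : Fin K → Fin m → Bool) :
    (∑ i, ∑ j, if x i j = y i j then 1 else 0) + hdist K m x y = K * m := by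
  unfold hdist
  simp only [← Finset.sum_add_distrib]
  have : ∀ i j, ((if x i j = y i j then 1 else 0) + if x i j = y i j then 0 else 1) = 1 := by
    intro i j; split_ifs <;> rfl
  simp [this]

lemma mutR_prod (x y : Fin K → Fin m → Bool) :
    mutR x y = ∏ i, ∏ j, (if x i j = y i j then (1 - 1 / (K * m : ℝ)) else 1 / (K * m : ℝ)) := by
  have h := hdist_compl x y
  have e : K * m - hdist K m x y = ∑ i, ∑ j, if x i j = y i j then 1 else 0 := by omega
  unfold mutR
  rw [e]
  unfold hdist
  simp only [← Finset.prod_pow_eq_pow_sum, ← Finset.prod_mul_distrib]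
  refine Finset.prod_congr rfl fun i _ => Finset.prod_congr rfl fun j _ => ?_
  split_ifs <;> simp

lemma mutR_sum (x : Fin K → Fin m → Bool) : ∑ y, mutR x y = 1 := by
  simp only [mutR_prod]
  have h1 := Finset.prod_univ_sum (fun _ : Fin K => (Finset.univ : Finset (Fin m → Bool)))
    (fun i (r : Fin m → Bool) =>
      ∏ j, (if x i j = r j then (1 - 1 / (K * m : ℝ)) else 1 / (K * m : ℝ)))
  rw [Fintype.piFinset_univ] at h1
  rw [← h1]
  refine Finset.prod_eq_one fun i _ => ?_
  have h2 := Finset.prod_univ_sum (fun _ : Fin m => (Finset.univ : Finset Bool))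
    (fun j (r : Bool) => (if x i j = r then (1 - 1 / (K * m : ℝ)) else 1 / (K * m : ℝ)))
  rw [Fintype.piFinset_univ] at h2
  rw [← h2]
  refine Finset.prod_eq_one fun j _ => ?_
  rw [Fintype.sum_bool]
  cases x i j <;> simp

lemma q_pow (hn : 2 ≤ K * m) : 1 / 3 ≤ (1 - 1 / ((K:ℝ) * m)) ^ (K * m - 2) := by
  obtain ⟨h1, h2⟩ := pq hn
  have hR := n_real hn
  obtain ⟨k, hk⟩ : ∃ k, K * m = k + 2 := ⟨K * m - 2, by omega⟩
  have hk' : (K:ℝ) * m = k + 2 := by exact_mod_cast hk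
  rw [hk, hk', Nat.add_sub_cancel]
  have hk0 : (0:ℝ) ≤ k := Nat.cast_nonneg k
  have e : (1 - 1 / ((k:ℝ) + 2)) = (1 + 1 / ((k:ℝ) + 1))⁻¹ := by field_simp; ring
  rw [e, inv_pow, one_div]
  apply inv_anti₀ (by positivity)
  have h3 : 1 + 1 / ((k:ℝ) + 1) ≤ Real.exp (1 / ((k:ℝ) + 1)) := by
    have := Real.add_one_le_exp (1 / ((k:ℝ) + 1)); linarith
  calc (1 + 1 / ((k:ℝ) + 1)) ^ k ≤ (Real.exp (1 / ((k:ℝ) + 1))) ^ k := by gcongr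
    _ = Real.exp (k * (1 / ((k:ℝ) + 1))) := by rw [← Real.exp_nat_mul]
    _ ≤ Real.exp 1 := by
        apply Real.exp_le_exp.2
        rw [mul_one_div, div_le_one (by positivity)]; linarith
    _ ≤ 3 := by linarith [Real.exp_one_lt_d9]

lemma mutR_lower (hn : 2 ≤ K * m) (x y : Fin K → Fin m → Bool) (h : hdist K m x y ≤ 2) :
    1 / (3 * ((K:ℝ) * m) ^ 2) ≤ mutR x y := by
  obtain ⟨h1, h2⟩ := pq hn
  have hq := q_pow hn
  have hR := n_real hn
  unfold mutR
  set p := 1 / ((K:ℝ) * m) with hp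
  have e : 1 / (3 * ((K:ℝ) * m) ^ 2) = p ^ 2 * (1 / 3) := by rw [hp]; field_simp
  have e2 : K * m - hdist K m x y = (2 - hdist K m x y) + (K * m - 2) := by omega
  have e3 : p ^ 2 = p ^ hdist K m x y * p ^ (2 - hdist K m x y) := by
    rw [← pow_add]; congr 1; omega
  rw [e, e2, pow_add, e3, mul_assoc]
  have h3 : p ^ (2 - hdist K m x y) ≤ (1 - p) ^ (2 - hdist K m x y) := by gcongr
  have h4 : 0 ≤ 1 - p := by linarith
  have h5 : 0 ≤ (1 - p) ^ (2 - hdist K m x y) := pow_nonneg h4 _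
  gcongr

lemma drift_hit (P : (Fin K → Fin m → Bool) → (Fin K → Fin m → Bool) → ℝ≥0∞)
    (A : (Fin K → Fin m → Bool) → Prop) (V : (Fin K → Fin m → Bool) → ℝ≥0∞)
    (hV : ∀ x, ¬ A x → 1 + ∑ y, P x y * V y ≤ V x) (x₀ : Fin K → Fin m → Bool) :
    expHitTime K m P A x₀ ≤ V x₀ := by
  classical
  have hA : ∀ t y, A y → hitVec K m P A x₀ t y = 0 := by
    intro t y hy
    cases t <;> simp [hitVec, hy]
  have key : ∀ N : ℕ, (∑ t ∈ Finset.range N, ∑ y, hitVec K m P A x₀ t y) +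
      ∑ y, hitVec K m P A x₀ N y * V y ≤ V x₀ := by
    intro N
    induction N with
    | zero =>
      simp only [Finset.range_zero, Finset.sum_empty, zero_add, hitVec]
      calc _ ≤ ∑ y, (if y = x₀ then V y else 0) := by
            refine Finset.sum_le_sum fun y _ => ?_
            by_cases h : y = x₀
            · by_cases h2 : A y <;> simp [h]
              split_ifs <;> simp
              split_ifs <;> simp
            · simp [h]
        _ = V x₀ := by simp
    | succ N ih =>
      refine le_trans ?_ ih
      rw [Finset.sum_range_succ, add_assoc]
      gcongr
      calc ∑ y, hitVec K m P A x₀ N y + ∑ y, hitVec K m P A x₀ (N + 1) y * V y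
          ≤ ∑ y, hitVec K m P A x₀ N y +
            ∑ y, (∑ x, hitVec K m P A x₀ N x * P x y) * V y := by
            gcongr with y
            simp only [hitVec]
            split_ifs <;> simp
        _ = ∑ x, hitVec K m P A x₀ N x * (1 + ∑ y, P x y * V y) := by
            simp only [Finset.sum_mul]
            rw [Finset.sum_comm, ← Finset.sum_add_distrib]
            refine Finset.sum_congr rfl fun x _ => ?_
            rw [mul_add, mul_one, Finset.mul_sum]
            simp only [mul_assoc]
        _ ≤ ∑ y, hitVec K m P A x₀ N y * V y := by
            refine Finset.sum_le_sum fun x _ => ?_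
            by_cases hx : A x
            · simp [hA N x hx]
            · gcongr; exact hV x hx
  unfold expHitTime
  rw [ENNReal.tsum_eq_iSup_nat]
  exact iSup_le fun N => le_trans le_self_add (key N)

lemma step_drift (hn : 2 ≤ K * m)
    (acc : (Fin K → Fin m → Bool) → (Fin K → Fin m → Bool) → Prop)
    (U : (Fin K → Fin m → Bool) → ℝ) (hU : ∀ x, 0 ≤ U x)
    (x : Fin K → Fin m → Bool) (hmon : ∀ y, acc y x → U y ≤ U x)
    (S : Finset (Fin K → Fin m → Bool)) (hS : ∀ y ∈ S, hdist K m x y ≤ 2 ∧ acc y x)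
    (hd : 1 ≤ ∑ y ∈ S, (U x - U y)) :
    1 + ∑ y, stepP K m (mutEA K m) acc x y * ENNReal.ofReal (3 * ((K:ℝ) * m) ^ 2 * U y)
      ≤ ENNReal.ofReal (3 * ((K:ℝ) * m) ^ 2 * U x) := by
  classical
  have hR := n_real hn
  set N : ℝ := 3 * ((K:ℝ) * m) ^ 2 with hN
  have hN0 : 0 < N := by positivity
  set W : (Fin K → Fin m → Bool) → ℝ := fun z => if acc z x then U z else U x with hW
  have hWx : ∀ z, W z ≤ U x := by
    intro z; simp only [hW]; split_ifs with h
    · exact hmon z h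
    · exact le_rfl
  have hW0 : ∀ z, 0 ≤ W z := by
    intro z; simp only [hW]; split_ifs <;> exact hU _
  have e1 : ∑ y, stepP K m (mutEA K m) acc x y * ENNReal.ofReal (N * U y)
      = ∑ z, mutEA K m x z * ENNReal.ofReal (N * W z) := by
    unfold stepP
    simp only [add_mul, Finset.sum_add_distrib, ite_mul, zero_mul, Finset.sum_ite_eq',
      Finset.mem_univ, if_true, Finset.sum_mul]
    rw [← Finset.sum_add_distrib]
    refine Finset.sum_congr rfl fun z _ => ?_
    simp only [hW]
    split_ifs <;> simp
  have e2 : ∑ z, mutEA K m x z * ENNReal.ofReal (N * W z)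
      = ENNReal.ofReal (∑ z, mutR x z * (N * W z)) := by
    rw [ENNReal.ofReal_sum_of_nonneg]
    · refine Finset.sum_congr rfl fun z _ => ?_
      rw [mutEA_eq hn, ENNReal.ofReal_mul (mutR_nonneg hn _ _)]
    · intro z _
      exact mul_nonneg (mutR_nonneg hn _ _) (mul_nonneg hN0.le (hW0 z))
  have e3 : ∑ z, mutR x z * (N * W z) ≤ N * U x - 1 := by
    have h1 : ∑ z, mutR x z * (N * W z) = N * U x - ∑ z, mutR x z * (N * (U x - W z)) := by
      have : ∑ z, mutR x z * (N * U x) = N * U x := by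
        rw [← Finset.sum_mul, mutR_sum, one_mul]
      rw [eq_sub_iff_add_eq, ← Finset.sum_add_distrib]
      refine Eq.trans (Finset.sum_congr rfl fun z _ => ?_) this
      ring
    have h2 : ∑ z ∈ S, (U x - U z) ≤ ∑ z, mutR x z * (N * (U x - W z)) := by
      calc ∑ z ∈ S, (U x - U z) ≤ ∑ z ∈ S, mutR x z * (N * (U x - W z)) := by
            refine Finset.sum_le_sum fun z hz => ?_
            obtain ⟨a, b⟩ := hS z hz
            have h3 := mutR_lower hn x z a
            rw [← hN] at h3
            have h4 : W z = U z := by simp [hW, b]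
            have h5 : 0 ≤ U x - U z := by linarith [hmon z b]
            rw [h4]
            calc U x - U z = (1 / N) * (N * (U x - U z)) := by field_simp
              _ ≤ _ := by gcongr
        _ ≤ _ := by
            refine Finset.sum_le_sum_of_subset_of_nonneg (Finset.subset_univ _) fun z _ _ => ?_
            have := hWx z
            exact mul_nonneg (mutR_nonneg hn _ _) (mul_nonneg hN0.le (by linarith))
    linarith
  rw [e1, e2]
  have h0 : 0 ≤ ∑ z, mutR x z * (N * W z) := Finset.sum_nonneg fun z _ =>
    mul_nonneg (mutR_nonneg hn _ _) (mul_nonneg hN0.le (hW0 z))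
  rw [← ENNReal.ofReal_one, ← ENNReal.ofReal_add zero_le_one h0]
  exact ENNReal.ofReal_le_ofReal (by linarith)

/-- truncated logarithm -/
def psi (z : ℝ) : ℝ := if z < 1 then 0 else 1 + Real.log z

lemma psi_nonneg (z : ℝ) : 0 ≤ psi z := by
  unfold psi; split_ifs with h
  · exact le_rfl
  · have := Real.log_nonneg (not_lt.1 h); linarith

lemma psi_mono {z w : ℝ} (h : z ≤ w) : psi z ≤ psi w := by
  by_cases hz : z < 1
  · have : psi z = 0 := by simp [psi, hz]
    rw [this]; exact psi_nonneg w
  · have hw : ¬ w < 1 := by linarith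
    simp only [psi, hz, hw, if_false]
    have := Real.log_le_log (by linarith) h
    linarith

lemma psi_drop {z w : ℝ} (hz : 1 ≤ z) (hw0 : 0 ≤ w) (_ : w ≤ z) : (z - w) / z ≤ psi z - psi w := by
  have hz0 : 0 < z := by linarith
  have e : psi z = 1 + Real.log z := by simp [psi, not_lt.2 hz]
  have e1 : (z - w) / z = 1 - w / z := by field_simp
  by_cases h : w < 1
  · have : psi w = 0 := by simp [psi, h]
    rw [e, this, e1]
    have := Real.log_nonneg hz
    have : 0 ≤ w / z := by positivity
    linarith
  · have : psi w = 1 + Real.log w := by simp [psi, h]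
    rw [e, this, e1]
    have h1 : Real.log (w / z) ≤ w / z - 1 :=
      Real.log_le_sub_one_of_pos (div_pos (by linarith) hz0)
    rw [Real.log_div (by linarith) (by linarith)] at h1
    linarith

lemma psi_sum {ι : Type*} (S : Finset ι) {z : ℝ} (w : ι → ℝ) (hz : 1 ≤ z)
    (hw : ∀ s ∈ S, 0 ≤ w s ∧ w s ≤ z) (hs : z ≤ ∑ s ∈ S, (z - w s)) :
    1 ≤ ∑ s ∈ S, (psi z - psi (w s)) := by
  have hz0 : 0 < z := by linarith
  calc 1 ≤ (∑ s ∈ S, (z - w s)) / z := by rwa [le_div_iff₀ hz0, one_mul]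
    _ = ∑ s ∈ S, (z - w s) / z := by rw [Finset.sum_div]
    _ ≤ _ := Finset.sum_le_sum fun s h => psi_drop hz (hw s h).1 (hw s h).2

lemma psi_le {z w : ℝ} (hw : 1 ≤ w) (h : z ≤ w) : psi z ≤ 1 + Real.log w := by
  refine (psi_mono h).trans ?_
  simp [psi, not_lt.2 hw]

lemma rr_nonneg (k : ℕ) : (0:ℝ) ≤ (k:ℝ) * k - k := by
  rcases Nat.eq_zero_or_pos k with h | h
  · simp [h]
  · have : (1:ℝ) ≤ k := by exact_mod_cast h
    nlinarith

lemma var_ge {d c : ℝ} (hc : 0 < c) (x : Fin K → Fin m → Bool) :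
    d * numOnes K m x ≤ varWeight K m d c x := by
  rw [var_eq]
  have : 0 ≤ ∑ i, ((rc x i : ℝ) * rc x i - rc x i) := Finset.sum_nonneg fun i _ => rr_nonneg _
  have := mul_nonneg hc.le this
  linarith

lemma var_nonneg {d c : ℝ} (hc : 0 < c) (hd : 0 < d) (x : Fin K → Fin m → Bool) :
    0 ≤ varWeight K m d c x := le_trans (by positivity) (var_ge (d := d) hc x)

lemma no_le (x : Fin K → Fin m → Bool) : numOnes K m x ≤ K * m := by
  unfold numOnes
  calc _ ≤ ∑ i : Fin K, ∑ j : Fin m, 1 := by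
        refine Finset.sum_le_sum fun i _ => Finset.sum_le_sum fun j _ => ?_
        split_ifs <;> simp
    _ = K * m := by simp

lemma rsum_le (x : Fin K → Fin m → Bool) :
    ∑ i, ((rc x i : ℝ) * rc x i - rc x i) ≤ ((K:ℝ) * m) ^ 2 := by
  have h1 : ∑ i, ((rc x i : ℝ) * rc x i - rc x i) ≤ ∑ i, (rc x i : ℝ) * ((K:ℝ) * m) := by
    refine Finset.sum_le_sum fun i _ => ?_
    have : rc x i ≤ K * m := by
      refine le_trans ?_ (no_le x)
      rw [numOnes_eq]
      exact Finset.single_le_sum (f := fun i => rc x i) (fun _ _ => Nat.zero_le _) (Finset.mem_univ i)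
    have : (rc x i : ℝ) ≤ (K:ℝ) * m := by exact_mod_cast this
    have h0 : (0:ℝ) ≤ rc x i := Nat.cast_nonneg _
    nlinarith
  rw [← Finset.sum_mul] at h1
  have h2 : (∑ i, (rc x i : ℝ)) ≤ (K:ℝ) * m := by
    have := no_le x
    rw [numOnes_eq] at this
    exact_mod_cast this
  have : (0:ℝ) ≤ (K:ℝ) * m := by positivity
  nlinarith

/-- number of in-group pairs -/
lemma pairs_even (x : Fin K → Fin m → Bool) :
    ∃ k : ℕ, ∑ i, ((rc x i : ℝ) * rc x i - rc x i) = 2 * k := by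
  refine ⟨∑ i, (rc x i) * (rc x i - 1) / 2, ?_⟩
  rw [Nat.cast_sum, Finset.mul_sum]
  refine Finset.sum_congr rfl fun i _ => ?_
  have h1 : 2 * ((rc x i) * (rc x i - 1) / 2) = (rc x i) * (rc x i - 1) :=
    Nat.mul_div_cancel' (Nat.even_mul_pred_self _).two_dvd
  have h2 : (rc x i) * (rc x i - 1) + rc x i = rc x i * rc x i := by
    cases rc x i with
    | zero => rfl
    | succ n => simp; ring
  have h3 : (2:ℝ) * (((rc x i) * (rc x i - 1) / 2 : ℕ) : ℝ) + rc x i = rc x i * rc x i := by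
    exact_mod_cast (by rw [h1, h2] : 2 * ((rc x i) * (rc x i - 1) / 2) + rc x i = rc x i * rc x i)
  linarith

lemma var_gap {d c : ℝ} (hc : 0 < c) (x y : Fin K → Fin m → Bool)
    (h : numOnes K m x = numOnes K m y) (hlt : varWeight K m d c y < varWeight K m d c x) :
    2 * c ≤ varWeight K m d c x - varWeight K m d c y := by
  obtain ⟨k, hk⟩ := pairs_even x
  obtain ⟨k', hk'⟩ := pairs_even y
  rw [var_eq, var_eq, hk, hk', h] at hlt
  rw [var_eq, var_eq, hk, hk', h]
  have h1 : (k' : ℝ) < k := by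
    by_contra hcon
    push Not at hcon
    have := mul_le_mul_of_nonneg_left hcon hc.le
    linarith
  have h2 : k' + 1 ≤ k := by exact_mod_cast h1
  have h3 : (k' : ℝ) + 1 ≤ k := by exact_mod_cast h2
  nlinarith

section Fit

variable {a d c B α : ℝ}

/-- ratio variance / squared slack -/
def rat (a d c B : ℝ) (x : Fin K → Fin m → Bool) : ℝ :=
  varWeight K m d c x / (B - expWeight K m a x) ^ 2

lemma beta_lt_one (hc : 0 < c) (hd : 0 < d) {x : Fin K → Fin m → Bool}
    (hx : expWeight K m a x < B) : chebBeta K m a d c B x < 1 := by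
  have hv := var_nonneg hc hd x
  have hs : 0 < (B - expWeight K m a x) ^ 2 := pow_pos (by linarith) 2
  unfold chebBeta
  rw [div_lt_one (by linarith)]; linarith

lemma beta_le_iff (hc : 0 < c) (hd : 0 < d) {x y : Fin K → Fin m → Bool}
    (hx : expWeight K m a x < B) (hy : expWeight K m a y < B) :
    chebBeta K m a d c B y ≤ chebBeta K m a d c B x ↔ rat a d c B y ≤ rat a d c B x := by
  have hv := var_nonneg hc hd x
  have hv' := var_nonneg hc hd y
  have hs : 0 < (B - expWeight K m a x) ^ 2 := pow_pos (by linarith) 2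
  have hs' : 0 < (B - expWeight K m a y) ^ 2 := pow_pos (by linarith) 2
  unfold chebBeta rat
  rw [div_le_div_iff₀ (by linarith) (by linarith), div_le_div_iff₀ hs' hs]
  constructor <;> intro h <;> nlinarith

lemma feas_iff (hα1 : α < 1) {x : Fin K → Fin m → Bool} :
    feasible K m a d c B α x ↔ ¬ α < betaPrime K m a d c B x := by
  unfold feasible betaPrime
  split_ifs with h
  · simp [h]
  · simp only [h, false_and, false_iff, not_not]
    push Not at h
    linarith

lemma pP_feas (hα1 : α < 1) (prof : Fin m → ℕ) {x : Fin K → Fin m → Bool}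
    (h : feasible K m a d c B α x) :
    pPrime K m a d c B α (fun _ j => (prof j : ℝ)) x = prN prof x := by
  unfold pPrime
  rw [if_neg ((feas_iff hα1).1 h), profitOf_eq]

lemma pP_infeas (hα1 : α < 1) (prof : Fin m → ℕ) {x : Fin K → Fin m → Bool}
    (h : ¬ feasible K m a d c B α x) :
    pPrime K m a d c B α (fun _ j => (prof j : ℝ)) x = -1 := by
  unfold pPrime
  rw [if_pos]
  by_contra h'
  exact h ((feas_iff hα1).2 h')

lemma betaP_lt {x : Fin K → Fin m → Bool} (h : expWeight K m a x < B) :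
    betaPrime K m a d c B x = chebBeta K m a d c B x := if_pos h

lemma betaP_ge {x : Fin K → Fin m → Bool} (h : ¬ expWeight K m a x < B) :
    betaPrime K m a d c B x = 1 + expWeight K m a x - B := if_neg h

lemma acc_cases (ha : 0 < a) (hc : 0 < c) (hd : 0 < d) (prof : Fin m → ℕ)
    {x y : Fin K → Fin m → Bool}
    (h : fge K m a d c B α (fun _ j => (prof j : ℝ)) y x) :
    pPrime K m a d c B α (fun _ j => (prof j : ℝ)) x <
      pPrime K m a d c B α (fun _ j => (prof j : ℝ)) y ∨
    (pPrime K m a d c B α (fun _ j => (prof j : ℝ)) y =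
      pPrime K m a d c B α (fun _ j => (prof j : ℝ)) x ∧
      (expWeight K m a x < B → expWeight K m a y < B ∧ rat a d c B y ≤ rat a d c B x) ∧
      (¬ expWeight K m a x < B → expWeight K m a y < B ∨ numOnes K m y ≤ numOnes K m x)) := by
  rcases h with h | ⟨h1, h2⟩
  · exact Or.inl h
  · refine Or.inr ⟨h1, ?_, ?_⟩
    · intro hx
      rw [betaP_lt hx] at h2
      have h3 := beta_lt_one hc hd hx
      have hy : expWeight K m a y < B := by
        by_contra hy
        rw [betaP_ge hy] at h2
        push Not at hy
        linarith
      rw [betaP_lt hy] at h2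
      exact ⟨hy, (beta_le_iff hc hd hx hy).1 h2⟩
    · intro hx
      by_cases hy : expWeight K m a y < B
      · exact Or.inl hy
      · right
        rw [betaP_ge hx, betaP_ge hy] at h2
        have h3 : expWeight K m a y ≤ expWeight K m a x := by linarith
        unfold expWeight at h3
        have := le_of_mul_le_mul_left h3 ha
        exact_mod_cast this

lemma mono_all (ha : 0 < a) (hc : 0 < c) (hd : 0 < d) {x y : Fin K → Fin m → Bool}
    (hx : expWeight K m a x < B) (hn : numOnes K m y ≤ numOnes K m x)
    (hv : varWeight K m d c y ≤ varWeight K m d c x) :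
    expWeight K m a y < B ∧ chebBeta K m a d c B y ≤ chebBeta K m a d c B x ∧
      rat a d c B y * (B - expWeight K m a x) ^ 2 ≤ varWeight K m d c y := by
  have h1 : expWeight K m a y ≤ expWeight K m a x := by
    unfold expWeight
    have : (numOnes K m y : ℝ) ≤ numOnes K m x := by exact_mod_cast hn
    gcongr
  have hy : expWeight K m a y < B := lt_of_le_of_lt h1 hx
  have hs : 0 < (B - expWeight K m a x) ^ 2 := pow_pos (by linarith) 2
  have hs' : 0 < (B - expWeight K m a y) ^ 2 := pow_pos (by linarith) 2
  have hss : (B - expWeight K m a x) ^ 2 ≤ (B - expWeight K m a y) ^ 2 :=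
    pow_le_pow_left₀ (by linarith) (by linarith) 2
  have hvy := var_nonneg hc hd y
  refine ⟨hy, (beta_le_iff hc hd hx hy).2 ?_, ?_⟩
  · unfold rat
    rw [div_le_div_iff₀ hs' hs]
    exact mul_le_mul hv hss hs.le (by linarith)
  · unfold rat
    rw [div_mul_eq_mul_div, div_le_iff₀ hs']
    exact mul_le_mul_of_nonneg_left hss hvy

lemma feas_mono (ha : 0 < a) (hc : 0 < c) (hd : 0 < d) {x y : Fin K → Fin m → Bool}
    (hx : feasible K m a d c B α x) (hn : numOnes K m y ≤ numOnes K m x)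
    (hv : varWeight K m d c y ≤ varWeight K m d c x) : feasible K m a d c B α y := by
  obtain ⟨h1, h2, -⟩ := mono_all ha hc hd hx.1 hn hv
  exact ⟨h1, h2.trans hx.2⟩

lemma acc_mono (ha : 0 < a) (hc : 0 < c) (hd : 0 < d) (hα1 : α < 1) (prof : Fin m → ℕ)
    {x y : Fin K → Fin m → Bool}
    (hx : expWeight K m a x < B) (hn : numOnes K m y ≤ numOnes K m x)
    (hv : varWeight K m d c y ≤ varWeight K m d c x)
    (hp : ¬ feasible K m a d c B α x ∨ prN prof x ≤ prN prof y) :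
    fge K m a d c B α (fun _ j => (prof j : ℝ)) y x := by
  obtain ⟨h1, h2, -⟩ := mono_all ha hc hd hx hn hv
  have hb : betaPrime K m a d c B y ≤ betaPrime K m a d c B x := by
    rw [betaP_lt hx, betaP_lt h1]; exact h2
  unfold fge
  by_cases hfx : feasible K m a d c B α x
  · have hfy := feas_mono ha hc hd hfx hn hv
    have hp := hp.resolve_left (not_not.2 hfx)
    rw [pP_feas hα1 prof hfx, pP_feas hα1 prof hfy]
    have hp : (prN prof x : ℝ) ≤ prN prof y := by exact_mod_cast hp
    rcases hp.lt_or_eq with h | h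
    · exact Or.inl h
    · exact Or.inr ⟨h.symm, hb⟩
  · rw [pP_infeas hα1 prof hfx]
    by_cases hfy : feasible K m a d c B α y
    · left
      rw [pP_feas hα1 prof hfy]
      have : (0:ℝ) ≤ prN prof y := Nat.cast_nonneg _
      linarith
    · right
      rw [pP_infeas hα1 prof hfy]
      exact ⟨rfl, hb⟩

lemma acc_gain (hα1 : α < 1) (prof : Fin m → ℕ) {x y : Fin K → Fin m → Bool}
    (hfx : feasible K m a d c B α x) (hfy : feasible K m a d c B α y)
    (hp : prN prof x < prN prof y) :
    fge K m a d c B α (fun _ j => (prof j : ℝ)) y x := by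
  left
  rw [pP_feas hα1 prof hfx, pP_feas hα1 prof hfy]
  exact_mod_cast hp

lemma acc_over (ha : 0 < a) (hc : 0 < c) (hd : 0 < d) (hα1 : α < 1) (prof : Fin m → ℕ)
    {x y : Fin K → Fin m → Bool}
    (hx : ¬ expWeight K m a x < B) (hn : numOnes K m y ≤ numOnes K m x) :
    fge K m a d c B α (fun _ j => (prof j : ℝ)) y x := by
  have hfx : ¬ feasible K m a d c B α x := fun h => hx h.1
  unfold fge
  rw [pP_infeas hα1 prof hfx]
  by_cases hfy : feasible K m a d c B α y
  · left
    rw [pP_feas hα1 prof hfy]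
    have : (0:ℝ) ≤ prN prof y := Nat.cast_nonneg _
    linarith
  · right
    rw [pP_infeas hα1 prof hfy]
    refine ⟨rfl, ?_⟩
    rw [betaP_ge hx]
    push Not at hx
    by_cases hy : expWeight K m a y < B
    · rw [betaP_lt hy]
      have := beta_lt_one hc hd hy
      linarith
    · rw [betaP_ge hy]
      have : (numOnes K m y : ℝ) ≤ numOnes K m x := by exact_mod_cast hn
      have : expWeight K m a y ≤ expWeight K m a x := by unfold expWeight; gcongr
      linarith

end Fit

lemma G_succ (prof : Fin m → ℕ) {l : ℕ} (h : l < K * m) :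
    prN prof (tgt K m (l + 1)) = prN prof (tgt K m l) + prof (nxt K m l h).2 := by
  rw [tgt_succ h, pr_true _ _ _ (tgt_nxt_false h)]

lemma vT_succ (d c : ℝ) {l : ℕ} (h : l < K * m) :
    varWeight K m d c (tgt K m (l + 1)) = varWeight K m d c (tgt K m l) + d
      + 2 * c * rc (tgt K m l) (nxt K m l h).1 := by
  rw [tgt_succ h, var_true _ _ _ _ (tgt_nxt_false h)]

lemma GvT_mono (prof : Fin m → ℕ) {d c : ℝ} (hc : 0 < c) (hd : 0 < d) {l l' : ℕ} (hl : l ≤ l') :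
    l' ≤ K * m → prN prof (tgt K m l) ≤ prN prof (tgt K m l') ∧
      varWeight K m d c (tgt K m l) ≤ varWeight K m d c (tgt K m l') := by
  induction l', hl using Nat.le_induction with
  | base => intro _; exact ⟨le_rfl, le_rfl⟩
  | succ l' hl ih =>
    intro h
    obtain ⟨h1, h2⟩ := ih (by omega)
    rw [G_succ prof h, vT_succ d c h]
    refine ⟨by omega, ?_⟩
    have : 0 ≤ 2 * c * (rc (tgt K m l') (nxt K m l' h).1 : ℝ) := by positivity
    linarith

section Pot

variable {a d c B α : ℝ}

def potF (a d c B α : ℝ) (prof : Fin m → ℕ) (j : ℕ) (x : Fin K → Fin m → Bool) : ℝ :=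
  psi ((prN prof (tgt K m j) : ℝ) - pPrime K m a d c B α (fun _ j => (prof j : ℝ)) x)

open scoped Classical in
def potWz (a d c B α R : ℝ) (prof : Fin m → ℕ) (j : ℕ) (x : Fin K → Fin m → Bool) : ℝ :=
  if pPrime K m a d c B α (fun _ j => (prof j : ℝ)) x < prN prof (tgt K m j) then R
  else if pPrime K m a d c B α (fun _ j => (prof j : ℝ)) x = prN prof (tgt K m j) then
    min R ((rat a d c B x * (B - a * j) ^ 2 - varWeight K m d c (tgt K m j)) / (2 * c))
  else 0

open scoped Classical in
def potI (a d c B α : ℝ) (prof : Fin m → ℕ) (j : ℕ) (x : Fin K → Fin m → Bool) : ℝ :=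
  if pPrime K m a d c B α (fun _ j => (prof j : ℝ)) x < 0 ∧ ¬ expWeight K m a x < B ∧
    j ≤ numOnes K m x then 1 else 0

open scoped Classical in
def potDz (a d c B α R : ℝ) (prof : Fin m → ℕ) (j : ℕ) (x : Fin K → Fin m → Bool) : ℝ :=
  if pPrime K m a d c B α (fun _ j => (prof j : ℝ)) x < 0 then
    (if expWeight K m a x < B then min R (rat a d c B x * (B - a * j) ^ 2 / d) else R)
  else 0

lemma potF_mono (ha : 0 < a) (hc : 0 < c) (hd : 0 < d) (prof : Fin m → ℕ) (j : ℕ)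
    {x y : Fin K → Fin m → Bool} (h : fge K m a d c B α (fun _ j => (prof j : ℝ)) y x) :
    potF a d c B α prof j y ≤ potF a d c B α prof j x := by
  apply psi_mono
  rcases acc_cases ha hc hd prof h with h | ⟨h, -⟩ <;> linarith

lemma rat_nonneg (hc : 0 < c) (hd : 0 < d) (x : Fin K → Fin m → Bool) : 0 ≤ rat a d c B x :=
  div_nonneg (var_nonneg hc hd x) (sq_nonneg _)

lemma pP_nonneg_feas (hα1 : α < 1) (prof : Fin m → ℕ) {x : Fin K → Fin m → Bool}
    (h : 0 ≤ pPrime K m a d c B α (fun _ j => (prof j : ℝ)) x) : feasible K m a d c B α x := by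
  by_contra h'
  rw [pP_infeas hα1 prof h'] at h
  linarith

lemma potW_mono (ha : 0 < a) (hc : 0 < c) (hd : 0 < d) (hα1 : α < 1) {R : ℝ} (hR : 0 ≤ R)
    (prof : Fin m → ℕ) (j : ℕ)
    {x y : Fin K → Fin m → Bool} (h : fge K m a d c B α (fun _ j => (prof j : ℝ)) y x) :
    psi (potWz a d c B α R prof j y) ≤ psi (potWz a d c B α R prof j x) := by
  have h0 : (0:ℝ) ≤ prN prof (tgt K m j) := Nat.cast_nonneg _
  have hle : ∀ z : Fin K → Fin m → Bool, potWz a d c B α R prof j z ≤ R := by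
    intro z; unfold potWz
    split_ifs
    · exact le_rfl
    · exact min_le_left _ _
    · exact hR
  rcases acc_cases ha hc hd prof h with h | ⟨h, h1, -⟩
  · by_cases hx : pPrime K m a d c B α (fun _ j => (prof j : ℝ)) x < prN prof (tgt K m j)
    · apply psi_mono
      refine (hle y).trans (le_of_eq ?_)
      unfold potWz; rw [if_pos hx]
    · have : potWz a d c B α R prof j y = 0 := by
        unfold potWz
        rw [if_neg (by linarith), if_neg (by intro h; linarith)]
      rw [this]
      simp only [psi]
      rw [if_pos (by norm_num)]
      exact psi_nonneg _
  · apply psi_mono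
    unfold potWz
    rw [h]
    split_ifs with h2 h3
    · exact le_rfl
    · have hf : feasible K m a d c B α x := pP_nonneg_feas hα1 prof (by linarith)
      have h4 := (h1 hf.1).2
      gcongr
    · exact le_rfl

lemma potI_mono (ha : 0 < a) (hc : 0 < c) (hd : 0 < d) (hα1 : α < 1) (prof : Fin m → ℕ) (j : ℕ)
    {x y : Fin K → Fin m → Bool} (h : fge K m a d c B α (fun _ j => (prof j : ℝ)) y x) :
    potI a d c B α prof j y ≤ potI a d c B α prof j x := by
  unfold potI
  split_ifs with h1 h2
  · exact le_rfl
  · exfalso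
    apply h2
    rcases acc_cases ha hc hd prof h with h | ⟨h, h3, h4⟩
    · exfalso
      have h5 : ¬ feasible K m a d c B α y := fun h => h1.2.1 h.1
      rw [pP_infeas hα1 prof h5] at h
      by_cases h6 : feasible K m a d c B α x
      · rw [pP_feas hα1 prof h6] at h
        have : (0:ℝ) ≤ prN prof x := Nat.cast_nonneg _
        linarith
      · rw [pP_infeas hα1 prof h6] at h
        linarith
    · have hx : ¬ expWeight K m a x < B := fun hx => h1.2.1 (h3 hx).1
      have h5 := (h4 hx).resolve_left h1.2.1
      exact ⟨h ▸ h1.1, hx, h1.2.2.trans h5⟩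
  · exact zero_le_one
  · exact le_rfl

lemma potD_mono (ha : 0 < a) (hc : 0 < c) (hd : 0 < d) (hα1 : α < 1) {R : ℝ} (hR : 0 ≤ R)
    (prof : Fin m → ℕ) (j : ℕ)
    {x y : Fin K → Fin m → Bool} (h : fge K m a d c B α (fun _ j => (prof j : ℝ)) y x) :
    psi (potDz a d c B α R prof j y) ≤ psi (potDz a d c B α R prof j x) := by
  apply psi_mono
  have h0 : ∀ z : Fin K → Fin m → Bool, 0 ≤ potDz a d c B α R prof j z := by
    intro z; unfold potDz
    have := rat_nonneg (a := a) (B := B) hc hd z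
    split_ifs
    · exact le_min hR (by positivity)
    · exact hR
    · exact le_rfl
  by_cases hy : pPrime K m a d c B α (fun _ j => (prof j : ℝ)) y < 0
  swap
  · have : potDz a d c B α R prof j y = 0 := if_neg hy
    rw [this]; exact h0 x
  have hfy : ¬ feasible K m a d c B α y := fun hf => by
    rw [pP_feas hα1 prof hf] at hy
    have : (0:ℝ) ≤ prN prof y := Nat.cast_nonneg _
    linarith
  rcases acc_cases ha hc hd prof h with h | ⟨h, h1, -⟩
  · exfalso
    rw [pP_infeas hα1 prof hfy] at h
    by_cases h6 : feasible K m a d c B α x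
    · rw [pP_feas hα1 prof h6] at h
      have : (0:ℝ) ≤ prN prof x := Nat.cast_nonneg _
      linarith
    · rw [pP_infeas hα1 prof h6] at h
      linarith
  · unfold potDz
    rw [← h, if_pos hy, if_pos hy]
    by_cases hx : expWeight K m a x < B
    · obtain ⟨h2, h3⟩ := h1 hx
      rw [if_pos hx, if_pos h2]
      gcongr
    · rw [if_neg hx]
      split_ifs
      · exact min_le_left _ _
      · exact le_rfl

/-- one-step drift -/
lemma drift_F (ha : 0 < a) (hc : 0 < c) (hd : 0 < d) (hα1 : α < 1)
    {prof : Fin m → ℕ} (hmono : ∀ j j' : Fin m, j ≤ j' → prof j' ≤ prof j)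
    {x : Fin K → Fin m → Bool} (hf : feasible K m a d c B α x)
    (hlt : prN prof x < prN prof (tgt K m (numOnes K m x))) :
    ∃ S : Finset (Fin K → Fin m → Bool),
      (∀ y ∈ S, hdist K m x y ≤ 2 ∧ fge K m a d c B α (fun _ j => (prof j : ℝ)) y x) ∧
      1 ≤ ∑ y ∈ S, (potF a d c B α prof (numOnes K m x) x
        - potF a d c B α prof (numOnes K m x) y) := by
  obtain ⟨S, h1, h2, h3, h4, h5⟩ := swaps hmono d c hc (no_le x) x rfl
  refine ⟨S, fun y hy => ?_, ?_⟩
  · obtain ⟨a1, a2, a3, a4⟩ := h1 y hy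
    exact ⟨a1, acc_mono ha hc hd hα1 prof hf.1 a2.le a4 (Or.inr a3)⟩
  · unfold potF
    apply psi_sum
    · rw [pP_feas hα1 prof hf]
      have : prN prof x + 1 ≤ prN prof (tgt K m (numOnes K m x)) := hlt
      have : (prN prof x : ℝ) + 1 ≤ prN prof (tgt K m (numOnes K m x)) := by exact_mod_cast this
      linarith
    · intro y hy
      obtain ⟨a1, a2, a3, a4⟩ := h1 y hy
      have hfy := feas_mono ha hc hd hf a2.le a4
      rw [pP_feas hα1 prof hf, pP_feas hα1 prof hfy]
      obtain ⟨S', -, -, -, -, h6⟩ := swaps hmono d c hc (no_le y) y rfl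
      rw [a2] at h6
      have h7 : (prN prof y : ℝ) ≤ prN prof (tgt K m (numOnes K m x)) := by exact_mod_cast h6
      have h8 : (prN prof x : ℝ) ≤ prN prof y := by exact_mod_cast a3
      constructor <;> linarith
    · rw [pP_feas hα1 prof hf, ← h2]
      refine Finset.sum_le_sum fun y hy => ?_
      obtain ⟨a1, a2, a3, a4⟩ := h1 y hy
      have hfy := feas_mono ha hc hd hf a2.le a4
      rw [pP_feas hα1 prof hfy]
      linarith

lemma rat_self {x : Fin K → Fin m → Bool}
    (h : expWeight K m a x < B) {j : ℕ} (hj : numOnes K m x = j) :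
    rat a d c B x * (B - a * j) ^ 2 = varWeight K m d c x := by
  unfold rat
  have : expWeight K m a x = a * j := by unfold expWeight; rw [hj]
  rw [← this]
  have hs : (B - expWeight K m a x) ^ 2 ≠ 0 := pow_ne_zero _ (by linarith)
  exact div_mul_cancel₀ _ hs

lemma var_up (hc : 0 < c) (hd : 0 < d) (hn : 2 ≤ K * m) (x : Fin K → Fin m → Bool) :
    varWeight K m d c x ≤ d * (((K:ℝ) * m) ^ 2 * (1 + c / d)) := by
  rw [var_eq]
  have h1 := rsum_le x
  have h2 : (numOnes K m x : ℝ) ≤ (K:ℝ) * m := by exact_mod_cast no_le x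
  have h3 := n_real hn
  have e : d * (((K:ℝ) * m) ^ 2 * (1 + c / d)) = d * ((K:ℝ) * m) ^ 2 + c * ((K:ℝ) * m) ^ 2 := by
    field_simp
  rw [e]
  have h4 : (numOnes K m x : ℝ) ≤ ((K:ℝ) * m) ^ 2 := by nlinarith
  gcongr

lemma drift_W (ha : 0 < a) (hc : 0 < c) (hd : 0 < d) (hα1 : α < 1) (hn : 2 ≤ K * m)
    {prof : Fin m → ℕ} (hmono : ∀ j j' : Fin m, j ≤ j' → prof j' ≤ prof j)
    {x : Fin K → Fin m → Bool} (hf : feasible K m a d c B α x)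
    (heq : prN prof x = prN prof (tgt K m (numOnes K m x)))
    (hv : varWeight K m d c (tgt K m (numOnes K m x)) < varWeight K m d c x) :
    ∃ S : Finset (Fin K → Fin m → Bool),
      (∀ y ∈ S, hdist K m x y ≤ 2 ∧ fge K m a d c B α (fun _ j => (prof j : ℝ)) y x) ∧
      1 ≤ ∑ y ∈ S, (psi (potWz a d c B α (((K:ℝ) * m) ^ 2 * (1 + c / d)) prof (numOnes K m x) x)
        - psi (potWz a d c B α (((K:ℝ) * m) ^ 2 * (1 + c / d)) prof (numOnes K m x) y)) := by
  obtain ⟨S, h1, h2, h3, h4, h5⟩ := swaps hmono d c hc (no_le x) x rfl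
  set R := ((K:ℝ) * m) ^ 2 * (1 + c / d) with hR
  have key : ∀ y, feasible K m a d c B α y → numOnes K m y = numOnes K m x →
      prN prof x ≤ prN prof y →
      potWz a d c B α R prof (numOnes K m x) y =
        (varWeight K m d c y - varWeight K m d c (tgt K m (numOnes K m x))) / (2 * c) ∧
      varWeight K m d c (tgt K m (numOnes K m x)) ≤ varWeight K m d c y := by
    intro y hfy hny hpy
    obtain ⟨S', -, -, -, h7, h6⟩ := swaps hmono d c hc (no_le y) y rfl
    rw [hny] at h6 h7
    have h8 : prN prof y = prN prof (tgt K m (numOnes K m x)) := by omega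
    refine ⟨?_, h7⟩
    unfold potWz
    rw [pP_feas hα1 prof hfy, h8, if_neg (lt_irrefl _), if_pos rfl,
      rat_self hfy.1 hny]
    apply min_eq_right
    rw [div_le_iff₀ (by linarith)]
    have e1 := var_eq d c y
    have e2 := var_ge (d := d) hc (tgt K m (numOnes K m x))
    rw [no_tgt (no_le x)] at e2
    rw [hny] at e1
    have e3 := mul_le_mul_of_nonneg_left (rsum_le y) hc.le
    have e4 : R * (2 * c) = 2 * (c * ((K:ℝ) * m) ^ 2) * (1 + c / d) := by rw [hR]; ring
    have e5 : 0 ≤ c * ((K:ℝ) * m) ^ 2 := by positivity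
    have e6 : 0 ≤ c * ((K:ℝ) * m) ^ 2 * (c / d) := by positivity
    rw [e4]
    linarith
  have hS : ∀ y ∈ S, feasible K m a d c B α y := fun y hy => by
    obtain ⟨a1, a2, a3, a4⟩ := h1 y hy
    exact feas_mono ha hc hd hf a2.le a4
  have kx := key x hf rfl le_rfl
  refine ⟨S, fun y hy => ?_, ?_⟩
  · obtain ⟨a1, a2, a3, a4⟩ := h1 y hy
    exact ⟨a1, acc_mono ha hc hd hα1 prof hf.1 a2.le a4 (Or.inr a3)⟩
  · have hc2 : 0 < 2 * c := by linarith
    apply psi_sum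
    · rw [kx.1, le_div_iff₀ hc2, one_mul]
      exact var_gap hc _ _ (no_tgt (no_le x)).symm hv
    · intro y hy
      obtain ⟨a1, a2, a3, a4⟩ := h1 y hy
      have ky := key y (hS y hy) a2 a3
      rw [kx.1, ky.1]
      constructor
      · apply div_nonneg _ hc2.le
        linarith [ky.2]
      · gcongr
    · have e : ∀ y ∈ S, potWz a d c B α R prof (numOnes K m x) x
          - potWz a d c B α R prof (numOnes K m x) y
          = (varWeight K m d c x - varWeight K m d c y) / (2 * c) := by
        intro y hy
        obtain ⟨a1, a2, a3, a4⟩ := h1 y hy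
        have ky := key y (hS y hy) a2 a3
        rw [kx.1, ky.1]; ring
      rw [Finset.sum_congr rfl e, kx.1, ← Finset.sum_div]
      gcongr

lemma drift_add (ha : 0 < a) (hc : 0 < c) (hd : 0 < d) (hα1 : α < 1)
    {prof : Fin m → ℕ} (hpos : ∀ j, 1 ≤ prof j)
    (hmono : ∀ j j' : Fin m, j ≤ j' → prof j' ≤ prof j)
    {x : Fin K → Fin m → Bool} (hf : feasible K m a d c B α x)
    (heq : prN prof x = prN prof (tgt K m (numOnes K m x)))
    (hv : varWeight K m d c x ≤ varWeight K m d c (tgt K m (numOnes K m x)))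
    (hlt : numOnes K m x < K * m) (hT : feasible K m a d c B α (tgt K m (numOnes K m x + 1))) :
    ∃ S : Finset (Fin K → Fin m → Bool),
      (∀ y ∈ S, hdist K m x y ≤ 2 ∧ fge K m a d c B α (fun _ j => (prof j : ℝ)) y x) ∧
      1 ≤ ∑ y ∈ S, (potF a d c B α prof (numOnes K m x + 1) x
        - potF a d c B α prof (numOnes K m x + 1) y) := by
  obtain ⟨f, h1, h2, h3⟩ := add_item hmono hlt x rfl
  have hG := G_succ prof hlt
  have hV := vT_succ d c hlt
  have hp := pr_true prof x f h1
  have hvy := var_true d c x f h1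
  have hfy : feasible K m a d c B α (setBit x f true) := by
    refine feas_mono ha hc hd hT ?_ ?_
    · rw [no_true x f h1, no_tgt hlt]
    · rw [hvy, hV]
      have : (rc x f.1 : ℝ) ≤ rc (tgt K m (numOnes K m x)) (nxt K m _ hlt).1 := by exact_mod_cast h3
      gcongr
  have hpf := hpos f.2
  have hpn := hpos (nxt K m _ hlt).2
  refine ⟨{setBit x f true}, fun y hy => ?_, ?_⟩
  · rw [Finset.mem_singleton] at hy
    subst hy
    exact ⟨(hdist_setBit _ _ _).trans (by norm_num), acc_gain hα1 prof hf hfy (by omega)⟩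
  · rw [Finset.sum_singleton]
    unfold potF
    rw [pP_feas hα1 prof hf, pP_feas hα1 prof hfy]
    have e1 : (prN prof (tgt K m (numOnes K m x + 1)) : ℝ) ≤ prN prof (setBit x f true) := by
      have : prN prof (tgt K m (numOnes K m x + 1)) ≤ prN prof (setBit x f true) := by omega
      exact_mod_cast this
    have e2 : (prN prof x : ℝ) + 1 ≤ prN prof (tgt K m (numOnes K m x + 1)) := by
      have : prN prof x + 1 ≤ prN prof (tgt K m (numOnes K m x + 1)) := by omega
      exact_mod_cast this
    have e3 : psi ((prN prof (tgt K m (numOnes K m x + 1)) : ℝ) - prN prof (setBit x f true)) = 0 := by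
      unfold psi; rw [if_pos (by linarith)]
    have e4 : psi 1 ≤ psi ((prN prof (tgt K m (numOnes K m x + 1)) : ℝ) - prN prof x) :=
      psi_mono (by linarith)
    have e5 : psi 1 = 1 := by simp [psi]
    rw [e3]; linarith

lemma drift_I (ha : 0 < a) (hc : 0 < c) (hd : 0 < d) (hα1 : α < 1) (hB : 0 < B)
    (prof : Fin m → ℕ) {x : Fin K → Fin m → Bool} (hx : ¬ expWeight K m a x < B) :
    ∃ S : Finset (Fin K → Fin m → Bool),
      (∀ y ∈ S, hdist K m x y ≤ 2 ∧ fge K m a d c B α (fun _ j => (prof j : ℝ)) y x) ∧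
      1 ≤ ∑ y ∈ S, (potI a d c B α prof (numOnes K m x) x
        - potI a d c B α prof (numOnes K m x) y) := by
  have he : ∃ e : Fin K × Fin m, x e.1 e.2 = true := by
    by_contra hcon
    push Not at hcon
    apply hx
    have : numOnes K m x = 0 := by
      unfold numOnes
      refine Finset.sum_eq_zero fun i _ => Finset.sum_eq_zero fun j _ => ?_
      have := hcon (i, j)
      simp at this
      simp [this]
    unfold expWeight
    rw [this]; simpa using hB
  obtain ⟨e, he⟩ := he
  have hn := no_false x e he
  refine ⟨{setBit x e false}, fun y hy => ?_, ?_⟩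
  · rw [Finset.mem_singleton] at hy
    subst hy
    exact ⟨(hdist_setBit _ _ _).trans (by norm_num), acc_over ha hc hd hα1 prof hx (by omega)⟩
  · rw [Finset.sum_singleton]
    have hfx : ¬ feasible K m a d c B α x := fun h => hx h.1
    have e1 : potI a d c B α prof (numOnes K m x) x = 1 := by
      unfold potI
      rw [if_pos]
      refine ⟨?_, hx, le_rfl⟩
      rw [pP_infeas hα1 prof hfx]; norm_num
    have e2 : potI a d c B α prof (numOnes K m x) (setBit x e false) = 0 := by
      unfold potI
      rw [if_neg]
      rintro ⟨-, -, h⟩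
      omega
    rw [e1, e2]; norm_num

lemma sum_ones (x : Fin K → Fin m → Bool) (g : Fin K → ℝ) :
    ∑ e ∈ Finset.univ.filter (fun e : Fin K × Fin m => x e.1 e.2 = true), g e.1
      = ∑ i, (rc x i : ℝ) * g i := by
  rw [Finset.sum_filter, Fintype.sum_prod_type]
  refine Finset.sum_congr rfl fun i _ => ?_
  unfold rc
  push_cast
  rw [Finset.sum_mul]
  refine Finset.sum_congr rfl fun j _ => ?_
  split_ifs <;> simp

lemma drift_D (ha : 0 < a) (hc : 0 < c) (hd : 0 < d) (hα0 : 0 < α) (hα1 : α < 1)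
    (hn : 2 ≤ K * m)
    (prof : Fin m → ℕ) {x : Fin K → Fin m → Bool} (hx : expWeight K m a x < B)
    (hf : ¬ feasible K m a d c B α x) :
    ∃ S : Finset (Fin K → Fin m → Bool),
      (∀ y ∈ S, hdist K m x y ≤ 2 ∧ fge K m a d c B α (fun _ j => (prof j : ℝ)) y x) ∧
      1 ≤ ∑ y ∈ S, (psi (potDz a d c B α (((K:ℝ) * m) ^ 2 * (1 + c / d)) prof (numOnes K m x) x)
        - psi (potDz a d c B α (((K:ℝ) * m) ^ 2 * (1 + c / d)) prof (numOnes K m x) y)) := by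
  set R := ((K:ℝ) * m) ^ 2 * (1 + c / d) with hR
  have hR0 : 0 ≤ R := by rw [hR]; positivity
  set O := Finset.univ.filter (fun e : Fin K × Fin m => x e.1 e.2 = true) with hO
  have hinj : Set.InjOn (fun e => setBit x e false) O := by
    intro e he f hf' hef
    simp only [hO, Finset.coe_filter, Finset.mem_univ, true_and, Set.mem_ofPred_eq] at he hf'
    obtain ⟨e1, e2⟩ := e
    obtain ⟨f1, f2⟩ := f
    have h1 := congrFun (congrFun hef e1) e2
    simp only [setBit] at h1 he hf'
    grind
  have hone : 1 ≤ numOnes K m x := by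
    by_contra hcon
    apply hf
    have h0 : numOnes K m x = 0 := by omega
    have hr : ∀ i, rc x i = 0 := by
      rw [numOnes_eq, Finset.sum_eq_zero_iff] at h0
      exact fun i => h0 i (Finset.mem_univ i)
    have hv0 : varWeight K m d c x = 0 := by
      rw [var_eq, h0]; simp [hr]
    refine ⟨hx, ?_⟩
    unfold chebBeta
    rw [hv0]; simp [hα0.le]
  have hxz : potDz a d c B α R prof (numOnes K m x) x = varWeight K m d c x / d := by
    unfold potDz
    rw [pP_infeas hα1 prof hf, if_pos (by norm_num), if_pos hx, rat_self hx rfl]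
    apply min_eq_right
    rw [div_le_iff₀ hd, mul_comm]
    exact var_up hc hd hn x
  have hO1 : ∀ e ∈ O, x e.1 e.2 = true := fun e he => (Finset.mem_filter.1 he).2
  have hrc1 : ∀ e ∈ O, (1:ℝ) ≤ rc x e.1 := by
    intro e he
    have := rc_false x e (hO1 e he) e.1
    rw [if_pos rfl] at this
    have : 1 ≤ rc x e.1 := by omega
    exact_mod_cast this
  have hvle : ∀ e ∈ O, varWeight K m d c (setBit x e false) ≤ varWeight K m d c x := by
    intro e he
    have h1 := var_false d c x e (hO1 e he)
    have h2 := hrc1 e he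
    have : 0 ≤ 2 * c * ((rc x e.1 : ℝ) - 1) := mul_nonneg (by linarith) (by linarith)
    linarith
  have hnle : ∀ e ∈ O, numOnes K m (setBit x e false) ≤ numOnes K m x := by
    intro e he
    have := no_false x e (hO1 e he)
    omega
  have hyz : ∀ e ∈ O, 0 ≤ potDz a d c B α R prof (numOnes K m x) (setBit x e false) ∧
      potDz a d c B α R prof (numOnes K m x) (setBit x e false) ≤
        varWeight K m d c (setBit x e false) / d := by
    intro e he
    obtain ⟨h1, -, h3⟩ := mono_all ha hc hd hx (hnle e he) (hvle e he)
    have h4 := rat_nonneg (a := a) (B := B) hc hd (setBit x e false)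
    have h5 := var_nonneg hc hd (setBit x e false)
    unfold potDz
    rw [if_pos h1]
    split_ifs
    · refine ⟨le_min hR0 (by positivity), (min_le_right _ _).trans ?_⟩
      unfold expWeight at h3
      gcongr
    · exact ⟨le_rfl, by positivity⟩
  refine ⟨O.image (fun e => setBit x e false), fun y hy => ?_, ?_⟩
  · obtain ⟨e, he, rfl⟩ := Finset.mem_image.1 hy
    exact ⟨(hdist_setBit _ _ _).trans (by norm_num),
      acc_mono ha hc hd hα1 prof hx (hnle e he) (hvle e he) (Or.inl hf)⟩
  · rw [Finset.sum_image hinj]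
    apply psi_sum
    · rw [hxz, le_div_iff₀ hd, one_mul]
      refine le_trans ?_ (var_ge hc x)
      have : (1:ℝ) ≤ numOnes K m x := by exact_mod_cast hone
      nlinarith
    · intro e he
      refine ⟨(hyz e he).1, (hyz e he).2.trans ?_⟩
      rw [hxz]
      have := hvle e he
      gcongr
    · rw [hxz]
      calc varWeight K m d c x / d
          ≤ (∑ e ∈ O, (d + 2 * c * ((rc x e.1 : ℝ) - 1))) / d := by
            gcongr
            rw [sum_ones x (fun i => d + 2 * c * ((rc x i : ℝ) - 1)), var_eq]
            have e1 : ∑ i, (rc x i : ℝ) * (d + 2 * c * ((rc x i : ℝ) - 1))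
                = d * numOnes K m x + 2 * (c * ∑ i, ((rc x i : ℝ) * rc x i - rc x i)) := by
              rw [numOnes_eq]
              push_cast
              rw [Finset.mul_sum, Finset.mul_sum, Finset.mul_sum, ← Finset.sum_add_distrib]
              refine Finset.sum_congr rfl fun i _ => ?_
              ring
            rw [e1]
            have : 0 ≤ c * ∑ i, ((rc x i : ℝ) * rc x i - rc x i) :=
              mul_nonneg hc.le (Finset.sum_nonneg fun i _ => rr_nonneg _)
            linarith
        _ = ∑ e ∈ O, (d + 2 * c * ((rc x e.1 : ℝ) - 1)) / d := by rw [Finset.sum_div]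
        _ ≤ _ := by
            refine Finset.sum_le_sum fun e he => ?_
            have h1 := (hyz e he).2
            have h2 := var_false d c x e (hO1 e he)
            have h3 : (d + 2 * c * ((rc x e.1 : ℝ) - 1)) / d
              = varWeight K m d c x / d - varWeight K m d c (setBit x e false) / d := by
              rw [h2]; ring
            linarith

end Pot

section Final

variable {a d c B α : ℝ}

def potC (a d c B α : ℝ) (prof : Fin m → ℕ) (j : ℕ) (x : Fin K → Fin m → Bool) : ℝ :=
  potF a d c B α prof j x + psi (potWz a d c B α (((K:ℝ) * m) ^ 2 * (1 + c / d)) prof j x)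
    + potI a d c B α prof j x + psi (potDz a d c B α (((K:ℝ) * m) ^ 2 * (1 + c / d)) prof j x)

def potU (a d c B α : ℝ) (prof : Fin m → ℕ) (x : Fin K → Fin m → Bool) : ℝ :=
  ∑ j ∈ Finset.range (K * m + 1), potC a d c B α prof j x

lemma potI_bd (prof : Fin m → ℕ) (j : ℕ) (x : Fin K → Fin m → Bool) :
    0 ≤ potI a d c B α prof j x ∧ potI a d c B α prof j x ≤ 1 := by
  unfold potI; split_ifs <;> norm_num

lemma potC_nonneg (prof : Fin m → ℕ) (j : ℕ) (x : Fin K → Fin m → Bool) :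
    0 ≤ potC a d c B α prof j x := by
  have h1 := (potI_bd (a := a) (d := d) (c := c) (B := B) (α := α) prof j x).1
  have h2 : 0 ≤ potF a d c B α prof j x := psi_nonneg _
  have h3 := psi_nonneg (potWz a d c B α (((K:ℝ) * m) ^ 2 * (1 + c / d)) prof j x)
  have h4 := psi_nonneg (potDz a d c B α (((K:ℝ) * m) ^ 2 * (1 + c / d)) prof j x)
  unfold potC
  linarith

lemma potU_nonneg (prof : Fin m → ℕ) (x : Fin K → Fin m → Bool) :
    0 ≤ potU a d c B α prof x := Finset.sum_nonneg fun j _ => potC_nonneg prof j x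

lemma R_nonneg (hc : 0 < c) (hd : 0 < d) : 0 ≤ ((K:ℝ) * m) ^ 2 * (1 + c / d) := by positivity

lemma potC_mono (ha : 0 < a) (hc : 0 < c) (hd : 0 < d) (hα1 : α < 1)
    (prof : Fin m → ℕ) (j : ℕ)
    {x y : Fin K → Fin m → Bool} (h : fge K m a d c B α (fun _ j => (prof j : ℝ)) y x) :
    potC a d c B α prof j y ≤ potC a d c B α prof j x := by
  have h1 := potF_mono ha hc hd prof j h
  have h2 := potW_mono ha hc hd hα1 (R_nonneg (K := K) (m := m) hc hd) prof j h
  have h3 := potI_mono ha hc hd hα1 prof j h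
  have h4 := potD_mono ha hc hd hα1 (R_nonneg (K := K) (m := m) hc hd) prof j h
  unfold potC
  linarith

lemma potU_mono (ha : 0 < a) (hc : 0 < c) (hd : 0 < d) (hα1 : α < 1)
    (prof : Fin m → ℕ)
    {x y : Fin K → Fin m → Bool} (h : fge K m a d c B α (fun _ j => (prof j : ℝ)) y x) :
    potU a d c B α prof y ≤ potU a d c B α prof x :=
  Finset.sum_le_sum fun j _ => potC_mono ha hc hd hα1 prof j h

lemma potU_drop (ha : 0 < a) (hc : 0 < c) (hd : 0 < d) (hα1 : α < 1)
    (prof : Fin m → ℕ) {j : ℕ} (hj : j ≤ K * m)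
    {x : Fin K → Fin m → Bool} (q : (Fin K → Fin m → Bool) → ℝ)
    (hq : ∀ y, fge K m a d c B α (fun _ j => (prof j : ℝ)) y x →
      q x - q y ≤ potC a d c B α prof j x - potC a d c B α prof j y)
    {S : Finset (Fin K → Fin m → Bool)}
    (hS : ∀ y ∈ S, hdist K m x y ≤ 2 ∧ fge K m a d c B α (fun _ j => (prof j : ℝ)) y x)
    (h1 : 1 ≤ ∑ y ∈ S, (q x - q y)) :
    1 ≤ ∑ y ∈ S, (potU a d c B α prof x - potU a d c B α prof y) := by
  refine h1.trans (Finset.sum_le_sum fun y hy => (hq y (hS y hy).2).trans ?_)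
  unfold potU
  rw [← Finset.sum_sub_distrib]
  exact Finset.single_le_sum (f := fun j => potC a d c B α prof j x - potC a d c B α prof j y)
    (fun i _ => sub_nonneg.2 (potC_mono ha hc hd hα1 prof i (hS y hy).2))
    (Finset.mem_range.2 (by omega))

lemma exists_S (ha : 0 < a) (hc : 0 < c) (hd : 0 < d) (hB : 0 < B) (hα0 : 0 < α) (hα1 : α < 1)
    (hn : 2 ≤ K * m) {prof : Fin m → ℕ} (hpos : ∀ j, 1 ≤ prof j)
    (hmono : ∀ j j' : Fin m, j ≤ j' → prof j' ≤ prof j) (x : Fin K → Fin m → Bool)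
    (hx : ¬ (feasible K m a d c B α x ∧ ∀ z, feasible K m a d c B α z →
                profitOf K m (fun _ j => (prof j : ℝ)) z ≤
                  profitOf K m (fun _ j => (prof j : ℝ)) x)) :
    ∃ S : Finset (Fin K → Fin m → Bool),
      (∀ y ∈ S, hdist K m x y ≤ 2 ∧ fge K m a d c B α (fun _ j => (prof j : ℝ)) y x) ∧
      1 ≤ ∑ y ∈ S, (potU a d c B α prof x - potU a d c B α prof y) := by
  have hR := R_nonneg (K := K) (m := m) hc hd
  have qF : ∀ j y, fge K m a d c B α (fun _ j => (prof j : ℝ)) y x →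
      potF a d c B α prof j x - potF a d c B α prof j y
        ≤ potC a d c B α prof j x - potC a d c B α prof j y := by
    intro j y h
    have h2 := potW_mono ha hc hd hα1 hR prof j h
    have h3 := potI_mono ha hc hd hα1 prof j h
    have h4 := potD_mono ha hc hd hα1 hR prof j h
    unfold potC
    linarith
  by_cases hE : expWeight K m a x < B
  swap
  · obtain ⟨S, hS, h1⟩ := drift_I ha hc hd hα1 hB prof hE
    refine ⟨S, hS, potU_drop ha hc hd hα1 prof (no_le x)
      (fun y => potI a d c B α prof (numOnes K m x) y) ?_ hS h1⟩
    intro y h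
    have h1 := potF_mono ha hc hd prof (numOnes K m x) h
    have h2 := potW_mono ha hc hd hα1 hR prof (numOnes K m x) h
    have h4 := potD_mono ha hc hd hα1 hR prof (numOnes K m x) h
    unfold potC
    linarith
  by_cases hf : feasible K m a d c B α x
  swap
  · obtain ⟨S, hS, h1⟩ := drift_D ha hc hd hα0 hα1 hn prof hE hf
    refine ⟨S, hS, potU_drop ha hc hd hα1 prof (no_le x)
      (fun y => psi (potDz a d c B α (((K:ℝ) * m) ^ 2 * (1 + c / d)) prof (numOnes K m x) y))
      ?_ hS h1⟩
    intro y h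
    have h1 := potF_mono ha hc hd prof (numOnes K m x) h
    have h2 := potW_mono ha hc hd hα1 hR prof (numOnes K m x) h
    have h3 := potI_mono ha hc hd hα1 prof (numOnes K m x) h
    unfold potC
    linarith
  obtain ⟨z, hz, hzp⟩ : ∃ z, feasible K m a d c B α z ∧ prN prof x < prN prof z := by
    by_contra hcon
    push Not at hcon
    refine hx ⟨hf, fun z hz => ?_⟩
    rw [profitOf_eq, profitOf_eq]
    exact_mod_cast hcon z hz
  obtain ⟨-, -, -, -, -, hle⟩ := swaps hmono d c hc (no_le x) x rfl
  rcases hle.lt_or_eq with hlt | heq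
  · obtain ⟨S, hS, h1⟩ := drift_F ha hc hd hα1 hmono hf hlt
    exact ⟨S, hS, potU_drop ha hc hd hα1 prof (no_le x)
      (fun y => potF a d c B α prof (numOnes K m x) y) (qF _) hS h1⟩
  rcases lt_or_ge (varWeight K m d c (tgt K m (numOnes K m x))) (varWeight K m d c x) with hv | hv
  · obtain ⟨S, hS, h1⟩ := drift_W ha hc hd hα1 hn hmono hf heq hv
    refine ⟨S, hS, potU_drop ha hc hd hα1 prof (no_le x)
      (fun y => psi (potWz a d c B α (((K:ℝ) * m) ^ 2 * (1 + c / d)) prof (numOnes K m x) y))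
      ?_ hS h1⟩
    intro y h
    have h1 := potF_mono ha hc hd prof (numOnes K m x) h
    have h3 := potI_mono ha hc hd hα1 prof (numOnes K m x) h
    have h4 := potD_mono ha hc hd hα1 hR prof (numOnes K m x) h
    unfold potC
    linarith
  obtain ⟨-, -, -, -, hvz, hpz⟩ := swaps hmono d c hc (no_le z) z rfl
  have hnz : numOnes K m x < numOnes K m z := by
    by_contra hcon
    have := (GvT_mono prof hc hd (not_lt.1 hcon) (no_le x)).1
    omega
  have hzK := no_le z
  have hT : feasible K m a d c B α (tgt K m (numOnes K m x + 1)) := by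
    refine feas_mono ha hc hd hz ?_ ?_
    · rw [no_tgt (by omega)]; exact hnz
    · exact (GvT_mono prof hc hd hnz hzK).2.trans hvz
  obtain ⟨S, hS, h1⟩ := drift_add ha hc hd hα1 hpos hmono hf heq hv (by omega) hT
  exact ⟨S, hS, potU_drop ha hc hd hα1 prof (j := numOnes K m x + 1) (by omega)
      (fun y => potF a d c B α prof (numOnes K m x + 1) y) (qF _) hS h1⟩

lemma prN_bd (prof : Fin m → ℕ) (x : Fin K → Fin m → Bool) :
    prN prof x ≤ K * m * Finset.univ.sup prof := by
  unfold prN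
  calc _ ≤ ∑ i : Fin K, ∑ j : Fin m, Finset.univ.sup prof := by
        refine Finset.sum_le_sum fun i _ => Finset.sum_le_sum fun j _ => ?_
        split_ifs
        · exact Finset.le_sup (f := prof) (Finset.mem_univ j)
        · exact Nat.zero_le _
    _ = _ := by simp [mul_assoc]

lemma potC_le (hc : 0 < c) (hd : 0 < d) (hα1 : α < 1)
    (hn : 2 ≤ K * m) (prof : Fin m → ℕ) (hp : 1 ≤ Finset.univ.sup prof)
    (j : ℕ) (x : Fin K → Fin m → Bool) :
    potC a d c B α prof j x ≤ (7 + 2 * Real.log (1 + c / d)) *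
      (1 + Real.log ((K:ℝ) * m) + Real.log ((Finset.univ.sup prof : ℕ) : ℝ)) := by
  have hn2 := n_real hn
  set N := (K:ℝ) * m with hN
  set R := N ^ 2 * (1 + c / d) with hR
  set P := ((Finset.univ.sup prof : ℕ) : ℝ) with hP
  have hP1 : 1 ≤ P := by rw [hP]; exact_mod_cast hp
  have hcd : 0 ≤ c / d := by positivity
  have hR1 : 1 ≤ R := by rw [hR]; nlinarith
  have hR0 : 0 ≤ R := by linarith
  have lN : 0 ≤ Real.log N := Real.log_nonneg (by linarith)
  have lP : 0 ≤ Real.log P := Real.log_nonneg hP1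
  have lk : 0 ≤ Real.log (1 + c / d) := Real.log_nonneg (by linarith)
  have lR : Real.log R = 2 * Real.log N + Real.log (1 + c / d) := by
    rw [hR, Real.log_mul (by positivity) (by positivity), Real.log_pow]; norm_num
  have l2 : Real.log 2 ≤ 1 := by
    have := Real.log_le_sub_one_of_pos (show (0:ℝ) < 2 by norm_num); linarith
  have h3 := (potI_bd (a := a) (d := d) (c := c) (B := B) (α := α) prof j x).2
  have h2 : psi (potWz a d c B α R prof j x) ≤ 1 + Real.log R := by
    apply psi_le hR1
    unfold potWz
    split_ifs
    · exact le_rfl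
    · exact min_le_left _ _
    · exact hR0
  have h4 : psi (potDz a d c B α R prof j x) ≤ 1 + Real.log R := by
    apply psi_le hR1
    unfold potDz
    split_ifs
    · exact min_le_left _ _
    · exact le_rfl
    · exact hR0
  have hNP : 1 ≤ N * P := by nlinarith
  have h1 : potF a d c B α prof j x ≤ 1 + Real.log (2 * (N * P)) := by
    apply psi_le (by linarith)
    have e1 : (prN prof (tgt K m j) : ℝ) ≤ N * P := by
      rw [hN, hP]; exact_mod_cast prN_bd prof (tgt K m j)
    have e2 : -1 ≤ pPrime K m a d c B α (fun _ j => (prof j : ℝ)) x := by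
      by_cases hf : feasible K m a d c B α x
      · rw [pP_feas hα1 prof hf]
        have : (0:ℝ) ≤ prN prof x := Nat.cast_nonneg _
        linarith
      · rw [pP_infeas hα1 prof hf]
    linarith
  rw [Real.log_mul (by norm_num) (by positivity), Real.log_mul (by positivity) (by positivity)] at h1
  rw [lR] at h2 h4
  unfold potC
  have m1 : 0 ≤ Real.log (1 + c / d) * (Real.log N + Real.log P) := by positivity
  nlinarith

lemma potU_le (hc : 0 < c) (hd : 0 < d) (hα1 : α < 1)
    (hn : 2 ≤ K * m) (prof : Fin m → ℕ) (hp : 1 ≤ Finset.univ.sup prof)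
    (x : Fin K → Fin m → Bool) :
    3 * ((K:ℝ) * m) ^ 2 * potU a d c B α prof x ≤
      6 * (7 + 2 * Real.log (1 + c / d)) * ((K:ℝ) * m) ^ 3 *
      (1 + Real.log ((K:ℝ) * m) + Real.log ((Finset.univ.sup prof : ℕ) : ℝ)) := by
  have hn2 := n_real hn
  set N := (K:ℝ) * m with hN
  set L := (7 + 2 * Real.log (1 + c / d)) *
      (1 + Real.log N + Real.log ((Finset.univ.sup prof : ℕ) : ℝ)) with hL
  have h1 : potU a d c B α prof x ≤ (N + 1) * L := by
    unfold potU
    refine (Finset.sum_le_card_nsmul _ _ L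
      (fun j _ => potC_le hc hd hα1 hn prof hp j x)).trans (le_of_eq ?_)
    rw [Finset.card_range, nsmul_eq_mul]
    push_cast
    rfl
  have hL0 : 0 ≤ L := (potC_nonneg (a := a) (B := B) (α := α) prof 0 x).trans
    (potC_le hc hd hα1 hn prof hp 0 x)
  have h2 : potU a d c B α prof x ≤ 2 * N * L := h1.trans (by nlinarith)
  calc 3 * N ^ 2 * potU a d c B α prof x ≤ 3 * N ^ 2 * (2 * N * L) := by gcongr
    _ = _ := by rw [hL]; ring

end Final

end Helpers

/-- (1+1) EA on the mirrored-profit instance with positive integer profits,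
`n = K·m ≥ 2`: there is a constant `C > 0` depending only on `c` and `d` such that, from
every initial solution, the expected number of iterations until the current solution is,
for the first time, a feasible solution of maximal profit among all feasible solutions is
at most `C·n³·(1 + log n + log p_max)`. -/
theorem EA_mirrored_profit_optimization (c d : ℝ) (hc : 0 < c) (hd : 0 < d) :
    ∃ C : ℝ, 0 < C ∧
      ∀ (K m : ℕ), 1 ≤ K → 1 ≤ m → 2 ≤ K * m →
      ∀ (a B α : ℝ), 0 < a → 0 < B → 0 < α → α < 1 →
      ∀ (prof : Fin m → ℕ), (∀ j, 1 ≤ prof j) →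
        (∀ j j' : Fin m, j ≤ j' → prof j' ≤ prof j) →
      ∀ x₀ : Fin K → Fin m → Bool,
        expHitTime K m
            (stepP K m (mutEA K m) (fge K m a d c B α (fun _ j => (prof j : ℝ))))
            (fun y => feasible K m a d c B α y ∧
              ∀ z, feasible K m a d c B α z →
                profitOf K m (fun _ j => (prof j : ℝ)) z ≤
                  profitOf K m (fun _ j => (prof j : ℝ)) y) x₀ ≤
          ENNReal.ofReal (C * (K * m : ℝ) ^ 3 *
            (1 + Real.log (K * m : ℝ) + Real.log ((Finset.univ.sup prof : ℕ) : ℝ))) := by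
  have hk : 0 ≤ Real.log (1 + c / d) := Real.log_nonneg (by
    have : 0 ≤ c / d := by positivity
    linarith)
  refine ⟨6 * (7 + 2 * Real.log (1 + c / d)), by positivity, ?_⟩
  intro K m _ hm hn a B α ha hB hα0 hα1 prof hpos hmono x₀
  have hp : 1 ≤ Finset.univ.sup prof :=
    (hpos ⟨0, hm⟩).trans (Finset.le_sup (f := prof) (Finset.mem_univ _))
  refine (drift_hit _ _ (fun x => ENNReal.ofReal (3 * ((K:ℝ) * m) ^ 2 * potU a d c B α prof x))
    ?_ x₀).trans (ENNReal.ofReal_le_ofReal (potU_le hc hd hα1 hn prof hp x₀))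
  intro x hx
  obtain ⟨S, hS, h1⟩ := exists_S ha hc hd hB hα0 hα1 hn hpos hmono x hx
  exact step_drift hn _ (potU a d c B α prof) (potU_nonneg prof) x
    (fun y h => potU_mono ha hc hd hα1 prof h) S hS h1
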